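/- Comparison theorem: let X^1, X^2 be two solutions of dX_u = (2β_u X_u + δ^i_u) du + σ(X_u) dW_u (i = 1,2) driven by the same Brownian motion W and same drift function β ∈ D, with dimensions δ^1, δ^2 ∈ D and initial states x^1, x^2 > 0. If x^2 ≥ x^1 and δ^2_u ≥ δ^1_u for all u ≥ 0, then for every u ≥ 0, P[X^2_u ≥ X^1_u] = 1. -/

import Mathlib

open MeasureTheory ProbabilityTheory Filter

noncomputable section

/-- The path space `C(ℝ⁺, ℝ)` modelled as functions `ℝ → ℝ`. -/
abbrev RPath : Type := ℝ → ℝ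

/-- The class `D` of nonnegative, measurable, locally bounded, piecewise
continuous functions. -/
def MemD (f : ℝ → ℝ) : Prop :=
  Measurable f ∧ (∀ t, 0 ≤ f t) ∧
    (∀ T : ℝ, ∃ C : ℝ, ∀ t ∈ Set.Icc (0 : ℝ) T, f t ≤ C) ∧
    ∃ S : Set ℝ, S.Countable ∧ ∀ t ∉ S, ContinuousAt f t

/-- `W` is a standard Brownian motion with respect to the filtration `ℱ`:
it starts at `0`, has continuous paths, is adapted, has Gaussian increments
`W t - W s ∼ N(0, t - s)` that are independent of `ℱ s`. -/
structure IsBrownianMotion {Ω : Type*} [m : MeasurableSpace Ω] (P : Measure Ω)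
    (ℱ : Filtration ℝ m) (W : ℝ → Ω → ℝ) : Prop where
  start : ∀ ω, W 0 ω = 0
  cont : ∀ ω, Continuous fun t => W t ω
  adapted : Adapted ℱ W
  gaussian_increments : ∀ s t : ℝ, 0 ≤ s → s ≤ t →
    P.map (fun ω => W t ω - W s ω) = gaussianReal 0 (Real.toNNReal (t - s))
  indep_increments : ∀ s t : ℝ, 0 ≤ s → s ≤ t →
    Indep (MeasurableSpace.comap (fun ω => W t ω - W s ω) (borel ℝ)) (ℱ s) P

/-- `X` is a (strong) solution of the SDE `dX_t = b(t, X_t) dt + σ(X_t) dW_t`,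
`X_0 = x`, formulated through the martingale problem relative to `W`:
`M_t := X_t - x - ∫_0^t b(s, X_s) ds` is a martingale, its quadratic variation
is `∫_0^t σ(X_s)² ds`, and its covariation with `W` is `∫_0^t σ(X_s) ds`
(the latter characterizes `M_t = ∫_0^t σ(X_s) dW_s`). -/
structure IsSDESolution {Ω : Type*} [m : MeasurableSpace Ω] (P : Measure Ω)
    (ℱ : Filtration ℝ m) (W : ℝ → Ω → ℝ)
    (b : ℝ → ℝ → ℝ) (σ : ℝ → ℝ) (x : ℝ) (X : ℝ → Ω → ℝ) : Prop where
  init : ∀ ω, X 0 ω = x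
  cont : ∀ ω, Continuous fun t => X t ω
  adapted : Adapted ℱ X
  drift_mart : Martingale
    (fun t ω => X t ω - x - ∫ s in Set.Ioc (0 : ℝ) t, b s (X s ω)) ℱ P
  quad_var : Martingale
    (fun t ω => (X t ω - x - ∫ s in Set.Ioc (0 : ℝ) t, b s (X s ω)) ^ 2
      - ∫ s in Set.Ioc (0 : ℝ) t, (σ (X s ω)) ^ 2) ℱ P
  driven_by : Martingale
    (fun t ω => (X t ω - x - ∫ s in Set.Ioc (0 : ℝ) t, b s (X s ω)) * W t ω
      - ∫ s in Set.Ioc (0 : ℝ) t, σ (X s ω)) ℱ P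

/-- The drift `(t, y) ↦ 2 β_t y + δ_t` of the generalized squared Bessel process. -/
def gbesqDrift (β δ : ℝ → ℝ) : ℝ → ℝ → ℝ := fun t y => 2 * β t * y + δ t

/-- The diffusion coefficient `y ↦ 2 √y` of the squared Bessel process. -/
def besqSigma : ℝ → ℝ := fun y => 2 * Real.sqrt y

/-- `X` is a generalized squared Bessel process `GBESQ^{β,δ}_x` driven by `W`. -/
def IsGBESQ {Ω : Type*} [m : MeasurableSpace Ω] (P : Measure Ω)
    (ℱ : Filtration ℝ m) (W : ℝ → Ω → ℝ) (β δ : ℝ → ℝ) (x : ℝ)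
    (X : ℝ → Ω → ℝ) : Prop :=
  IsSDESolution P ℱ W (gbesqDrift β δ) besqSigma x X

/-- The law on path space of a process `X`. -/
def pathLaw {Ω : Type*} [m : MeasurableSpace Ω] (P : Measure Ω)
    (X : ℝ → Ω → ℝ) : Measure RPath :=
  P.map fun ω t => X t ω

/-- A realization of the generalized squared Bessel process `GBESQ^{β,δ}_x`
whose law on path space is `μ`. -/
structure GBESQRealization (β δ : ℝ → ℝ) (x : ℝ) (μ : Measure RPath) where
  (Ω : Type)
  [m : MeasurableSpace Ω]
  (P : Measure Ω)
  (ℱ : Filtration ℝ m)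
  (W : ℝ → Ω → ℝ)
  (X : ℝ → Ω → ℝ)
  (prob : IsProbabilityMeasure P)
  (bm : IsBrownianMotion P ℱ W)
  (sol : IsGBESQ P ℱ W β δ x X)
  (law : μ = pathLaw P X)

/-- `μ` is the law `{}^β Q^δ_x` of the generalized squared Bessel process with
drift function `β`, dimension function `δ` and initial value `x`. -/
def IsGBESQLaw (β δ : ℝ → ℝ) (x : ℝ) (μ : Measure RPath) : Prop :=
  Nonempty (GBESQRealization β δ x μ)

/-- Convolution of two laws on path space: the law of the pathwise sum of
independent copies. -/
def mconv (μ ν : Measure RPath) : Measure RPath :=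
  (μ.prod ν).map fun p => p.1 + p.2


/-- Test functions of Yamada–Watanabe type. -/
structure GoodPhi (ε : ℝ) (φ φ' ρ : ℝ → ℝ) (K L : ℝ) : Prop where
  K0 : 0 ≤ K
  L0 : 0 ≤ L
  cφ : Continuous φ
  cφ' : Continuous φ'
  cρ : Continuous ρ
  φ_nonneg : ∀ x, 0 ≤ φ x
  φ_zero : ∀ x, x ≤ 0 → φ x = 0
  φ'_nonneg : ∀ x, 0 ≤ φ' x
  ρ_nonneg : ∀ x, 0 ≤ ρ x
  ρ_le : ∀ x, ρ x ≤ K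
  ρ_abs : ∀ x, ρ x * |x| ≤ ε
  xφ'_nonneg : ∀ x, 0 ≤ x * φ' x
  xφ'_le : ∀ x, x * φ' x ≤ φ x + ε * (φ x + ε)
  le_φ : ∀ x, x ≤ φ x + ε
  φ'_le : ∀ x, |φ' x| ≤ K * |x|
  φ_le : ∀ x, φ x ≤ K * x ^ 2
  taylor : ∀ a u w, φ (a + (u + w)) ≤ φ a + φ' a * (u + w) + ρ a * u ^ 2 / 2 + L * |u| ^ 3
      + K * |u| * |w| + K * w ^ 2

/-- Mean value inequality on the segment from `0` to `v`. -/
lemma mv_aux (f f' : ℝ → ℝ) (hf : ∀ x, HasDerivAt f (f' x) x) (v C : ℝ)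
    (hC : ∀ x, |x| ≤ |v| → |f' x| ≤ C) : |f v - f 0| ≤ C * |v| := by
  have h := (convex_closedBall (0:ℝ) |v|).norm_image_sub_le_of_norm_hasDerivWithin_le
    (f := f) (f' := f') (C := C) (x := 0) (y := v)
    (fun x _ => (hf x).hasDerivWithinAt)
    (fun x hx => hC x (by simpa using hx))
    (by simp) (by simp)
  simpa using h

lemma taylor_aux (φ φ' ρ : ℝ → ℝ) (K L : ℝ) (hK : 0 ≤ K) (hL : 0 ≤ L)
    (d1 : ∀ x, HasDerivAt φ (φ' x) x) (d2 : ∀ x, HasDerivAt φ' (ρ x) x)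
    (hρ : ∀ x, |ρ x| ≤ K) (hLip : ∀ x y, |ρ x - ρ y| ≤ L * |x - y|) (a u w : ℝ) :
    φ (a + (u + w)) ≤ φ a + φ' a * (u + w) + ρ a * u ^ 2 / 2 + L * |u| ^ 3
      + K * |u| * |w| + K * w ^ 2 := by
  have A1 : ∀ b v, |φ' (b + v) - φ' b| ≤ K * |v| := by
    intro b v
    have := mv_aux (fun x => φ' (b + x)) (fun x => ρ (b + x))
      (fun x => (d2 (b + x)).comp_const_add b x) v K (fun x _ => hρ _)
    simpa using this
  have A2 : ∀ b v, |φ (b + v) - φ b - φ' b * v| ≤ K * |v| * |v| := by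
    intro b v
    have := mv_aux (fun x => φ (b + x) - φ' b * x) (fun x => φ' (b + x) - φ' b * 1)
      (fun x => ((d1 (b + x)).comp_const_add b x).sub ((hasDerivAt_id x).const_mul _)) v (K * |v|)
      (fun x hx => by
        rw [mul_one]
        exact (A1 b x).trans (by gcongr))
    rw [show φ (b + v) - φ b - φ' b * v = φ (b + v) - φ' b * v - (φ (b + 0) - φ' b * 0) by
      simp; ring]
    exact this
  have A3 : ∀ b v, |φ' (b + v) - φ' b - ρ b * v| ≤ L * |v| * |v| := by
    intro b v
    have := mv_aux (fun x => φ' (b + x) - ρ b * x) (fun x => ρ (b + x) - ρ b * 1)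
      (fun x => ((d2 (b + x)).comp_const_add b x).sub ((hasDerivAt_id x).const_mul _)) v (L * |v|)
      (fun x hx => by
        rw [mul_one]
        refine (hLip _ _).trans ?_
        rw [add_sub_cancel_left]
        gcongr)
    rw [show φ' (b + v) - φ' b - ρ b * v = φ' (b + v) - ρ b * v - (φ' (b + 0) - ρ b * 0) by
      simp; ring]
    exact this
  have A4 : ∀ b v, |φ (b + v) - φ b - φ' b * v - ρ b * v ^ 2 / 2| ≤ L * |v| * |v| * |v| := by
    intro b v
    have := mv_aux (fun x => φ (b + x) - φ' b * x - ρ b * (x ^ 2 / 2))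
      (fun x => φ' (b + x) - φ' b * 1 - ρ b * x)
      (fun x => (((d1 (b + x)).comp_const_add b x).sub ((hasDerivAt_id x).const_mul _)).sub
        (HasDerivAt.const_mul _ (by simpa using ((hasDerivAt_id x).pow 2).div_const 2)))
      v (L * |v| * |v|)
      (fun x hx => by
        rw [mul_one]
        exact (A3 b x).trans (by gcongr))
    rw [show φ (b + v) - φ b - φ' b * v - ρ b * v ^ 2 / 2 = φ (b + v) - φ' b * v - ρ b * (v ^ 2 / 2)
      - (φ (b + 0) - φ' b * 0 - ρ b * (0 ^ 2 / 2)) by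
      simp; ring]
    exact this
  have e1 := (abs_le.1 (A2 (a + u) w)).2
  have e2 := (abs_le.1 (A4 a u)).2
  have e3 : (φ' (a + u) - φ' a) * w ≤ K * |u| * |w| := by
    refine (le_abs_self _).trans ?_
    rw [abs_mul]
    gcongr
    exact A1 a u
  have e4 : |w| * |w| = w ^ 2 := by rw [← sq, sq_abs]
  rw [← add_assoc]
  have e5 : K * |w| * |w| = K * w ^ 2 := by rw [mul_assoc, e4]
  nlinarith

lemma exists_phi (ε : ℝ) (hε : 0 < ε) : ∃ (φ φ' ρ : ℝ → ℝ) (K L : ℝ), GoodPhi ε φ φ' ρ K L := by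
  set η : ℝ := ε * Real.exp (-(1/ε)) with hη
  have hη0 : 0 < η := by positivity
  set g : ℝ → ℝ := fun x => x / (x ^ 2 + η ^ 2) with hg
  set ρ : ℝ → ℝ := fun x => ε * g (max x 0) with hρd
  have hden : ∀ x : ℝ, 0 < x ^ 2 + η ^ 2 := fun x => by positivity
  have cg : Continuous g := by
    simp only [hg]
    exact continuous_id.div (by fun_prop) (fun x => (hden x).ne')
  have cρ : Continuous ρ := by simp only [hρd]; fun_prop
  set φ' : ℝ → ℝ := fun x => ∫ t in (0:ℝ)..x, ρ t with hφ'
  have d2 : ∀ x, HasDerivAt φ' (ρ x) x := fun x => cρ.integral_hasStrictDerivAt 0 x |>.hasDerivAt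
  have cφ' : Continuous φ' := continuous_iff_continuousAt.2 fun x => (d2 x).continuousAt
  set φ : ℝ → ℝ := fun x => ∫ t in (0:ℝ)..x, φ' t with hφ
  have d1 : ∀ x, HasDerivAt φ (φ' x) x := fun x => cφ'.integral_hasStrictDerivAt 0 x |>.hasDerivAt
  have cφ : Continuous φ := continuous_iff_continuousAt.2 fun x => (d1 x).continuousAt
  have φ'0 : φ' 0 = 0 := by simp [hφ']
  have φ0 : φ 0 = 0 := by simp [hφ]
  have gnn : ∀ x, 0 ≤ x → 0 ≤ g x := fun x hx => div_nonneg hx (hden x).le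
  have ρnn : ∀ x, 0 ≤ ρ x := fun x => mul_nonneg hε.le (gnn _ (le_max_right _ _))
  have ρneg : ∀ x, x ≤ 0 → ρ x = 0 := fun x hx => by simp [hρd, hg, max_eq_right hx]
  have φ'mono : Monotone φ' := monotone_of_deriv_nonneg (fun x => (d2 x).differentiableAt)
    (fun x => by rw [(d2 x).deriv]; exact ρnn x)
  have φ'neg : ∀ x, x ≤ 0 → φ' x = 0 := by
    intro x hx
    simp only [hφ']
    rw [intervalIntegral.integral_congr (g := fun _ => 0)]
    · simp
    · intro t ht
      rw [Set.uIcc_of_ge hx] at ht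
      exact ρneg t ht.2
  have φ'nn : ∀ x, 0 ≤ φ' x := fun x => by
    rcases le_total x 0 with h | h
    · rw [φ'neg x h]
    · rw [← φ'0]; exact φ'mono h
  have φmono : Monotone φ := monotone_of_deriv_nonneg (fun x => (d1 x).differentiableAt)
    (fun x => by rw [(d1 x).deriv]; exact φ'nn x)
  have φneg : ∀ x, x ≤ 0 → φ x = 0 := by
    intro x hx
    simp only [hφ]
    rw [intervalIntegral.integral_congr (g := fun _ => 0)]
    · simp
    · intro t ht
      rw [Set.uIcc_of_ge hx] at ht
      exact φ'neg t ht.2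
  have φnn : ∀ x, 0 ≤ φ x := fun x => by
    rcases le_total x 0 with h | h
    · rw [φneg x h]
    · rw [← φ0]; exact φmono h
  have gle : ∀ x, g x ≤ 1 / η := by
    intro x
    simp only [hg]
    rw [div_le_div_iff₀ (hden x) hη0]
    nlinarith [sq_nonneg (x - η), sq_nonneg x, sq_nonneg η]
  have ρle : ∀ x, ρ x ≤ ε / η := fun x => by
    have := mul_le_mul_of_nonneg_left (gle (max x 0)) hε.le
    simp only [hρd]; rw [div_eq_mul_one_div]; exact this
  have ρabs : ∀ x, |ρ x| ≤ ε / η := fun x => by rw [abs_of_nonneg (ρnn x)]; exact ρle x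
  have gx : ∀ x, g x * x ≤ 1 := by
    intro x
    simp only [hg]
    rw [div_mul_eq_mul_div, div_le_one (hden x)]
    nlinarith [sq_nonneg η]
  have ρx : ∀ x, ρ x * |x| ≤ ε := by
    intro x
    rcases le_total x 0 with h | h
    · rw [ρneg x h]; simpa using hε.le
    · rw [abs_of_nonneg h]
      simp only [hρd, max_eq_left h]
      nlinarith [gx x]
  have gLip : ∀ x y, |g x - g y| ≤ 1 / η ^ 2 * |x - y| := by
    intro x y
    have e : g x - g y = (x - y) * ((η ^ 2 - x * y) / ((x ^ 2 + η ^ 2) * (y ^ 2 + η ^ 2))) := by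
      simp only [hg]
      have := (hden x).ne'
      have := (hden y).ne'
      field_simp
      ring
    rw [e, abs_mul, mul_comm]
    gcongr
    rw [abs_div, abs_of_pos (mul_pos (hden x) (hden y)), div_le_div_iff₀ (mul_pos (hden x) (hden y)) (by positivity)]
    have : |η ^ 2 - x * y| ≤ η ^ 2 + (x ^ 2 + y ^ 2) := by
      rw [abs_le]; constructor <;> nlinarith [sq_nonneg (x - y), sq_nonneg (x + y), sq_nonneg η]
    nlinarith [mul_le_mul_of_nonneg_right this (sq_nonneg η), mul_nonneg (sq_nonneg x) (sq_nonneg y)]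
  have ρLip : ∀ x y, |ρ x - ρ y| ≤ ε / η ^ 2 * |x - y| := by
    intro x y
    simp only [hρd]
    rw [← mul_sub, abs_mul, abs_of_pos hε, div_eq_mul_one_div, mul_assoc]
    gcongr
    exact (gLip _ _).trans
      (mul_le_mul_of_nonneg_left (abs_max_sub_max_le_abs x y 0) (by positivity))
  have tay := taylor_aux φ φ' ρ (ε / η) (ε / η ^ 2) (by positivity) (by positivity) d1 d2 ρabs ρLip
  -- value of the derivative at ε
  have φ'ε : 1 ≤ φ' ε := by
    have : φ' ε = (ε / 2 * Real.log (ε ^ 2 + η ^ 2)) - (ε / 2 * Real.log (0 ^ 2 + η ^ 2)) := by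
      simp only [hφ']
      refine intervalIntegral.integral_eq_sub_of_hasDerivAt (f := fun x => ε / 2 * Real.log (x ^ 2 + η ^ 2)) ?_
        (cρ.intervalIntegrable _ _)
      intro x hx
      rw [Set.uIcc_of_le hε.le] at hx
      have h1 : HasDerivAt (fun x : ℝ => x ^ 2 + η ^ 2) (2 * x) x := by
        simpa using ((hasDerivAt_id x).pow 2).add_const (η ^ 2)
      have h2 := (h1.log (hden x).ne').const_mul (ε / 2)
      convert! h2 using 1
      simp only [hρd, hg, max_eq_left hx.1]
      ring
    rw [this, ← mul_sub, ← Real.log_div (hden _).ne' (hden _).ne']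
    have : Real.exp (2 / ε) ≤ (ε ^ 2 + η ^ 2) / (0 ^ 2 + η ^ 2) := by
      rw [le_div_iff₀ (hden _)]
      have : Real.exp (2 / ε) * η ^ 2 = ε ^ 2 := by
        rw [hη, mul_pow, ← Real.exp_nat_mul]
        rw [mul_left_comm, ← Real.exp_add]
        have : 2 / ε + (2:ℕ) * -(1 / ε) = 0 := by push_cast; ring
        rw [this]; simp
      nlinarith [sq_nonneg η]
    have := (Real.le_log_iff_exp_le (by positivity)).2 this
    calc (1:ℝ) = ε / 2 * (2 / ε) := by field_simp
      _ ≤ _ := by gcongr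
  have leφ : ∀ x, x ≤ φ x + ε := by
    intro x
    rcases le_total x ε with h | h
    · linarith [φnn x]
    · have : MonotoneOn (fun x => φ x - x) (Set.Ici ε) := by
        refine monotoneOn_of_hasDerivWithinAt_nonneg (f' := fun x => φ' x - 1) (convex_Ici ε) (by fun_prop)
          (fun y _ => ((d1 y).sub (hasDerivAt_id y)).hasDerivWithinAt) ?_
        intro y hy
        rw [interior_Ici] at hy
        have := φ'mono (le_of_lt hy : ε ≤ y)
        linarith
      have := this (Set.mem_Ici.2 le_rfl) (Set.mem_Ici.2 h) h
      simp only at this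
      linarith [φnn ε]
  have xφ' : ∀ x, 0 ≤ x → x * φ' x ≤ φ x + ε * x := by
    intro x hx
    have : Monotone (fun x => φ x + ε * x - x * φ' x) := by
      refine monotone_of_deriv_nonneg (fun y => ?_) (fun y => ?_)
      · exact (((d1 y).add ((hasDerivAt_id y).const_mul ε)).sub
          ((hasDerivAt_id y).mul (d2 y))).differentiableAt
      · have h1 := (((d1 y).add ((hasDerivAt_id y).const_mul ε)).sub
          ((hasDerivAt_id y).mul (d2 y))).deriv
        have h2 : deriv (fun x => φ x + ε * x - x * φ' x) y = _ := h1
        rw [h2]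
        simp only [id]
        have := ρx y
        have := mul_le_mul_of_nonneg_left (le_abs_self y) (ρnn y)
        nlinarith
    have := this hx
    simp only [φ0, φ'0] at this
    linarith
  refine ⟨φ, φ', ρ, ε / η, ε / η ^ 2, by positivity, by positivity, cφ, cφ', cρ, φnn, φneg, φ'nn, ρnn,
    ρle, ρx, ?_, ?_, leφ, ?_, ?_, tay⟩
  · intro x
    rcases le_total x 0 with h | h
    · rw [φ'neg x h]; simp
    · exact mul_nonneg h (φ'nn x)
  · intro x
    rcases le_total x 0 with h | h
    · rw [φ'neg x h, φneg x h]; simp; positivity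
    · exact (xφ' x h).trans (by gcongr; exact leφ x)
  · intro x
    have := mv_aux φ' ρ d2 x (ε / η) (fun y _ => ρabs y)
    simpa [φ'0] using this
  · intro x
    have := tay 0 0 x
    simpa [φ0, φ'0] using this


set_option linter.unusedSectionVars false

section generic
variable {Ω : Type} [m : MeasurableSpace Ω] {P : Measure Ω} [IsProbabilityMeasure P]

lemma fub (Z : ℝ → Ω → ℝ) (hZ : Measurable (Function.uncurry Z)) (s t C : ℝ) (hst : s ≤ t)
    (hZint : ∀ r ∈ Set.Ioc s t, Integrable (Z r) P) (hC : ∀ r ∈ Set.Ioc s t, ∫ ω, |Z r ω| ∂P ≤ C) :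
    Integrable (fun ω => ∫ r in Set.Ioc s t, Z r ω) P ∧
    ∫ ω, (∫ r in Set.Ioc s t, Z r ω) ∂P = ∫ r in Set.Ioc s t, (∫ ω, Z r ω ∂P) ∧
    |∫ ω, (∫ r in Set.Ioc s t, Z r ω) ∂P| ≤ C * (t - s) ∧
    (∀ᵐ ω ∂P, IntegrableOn (fun r => Z r ω) (Set.Ioc s t)) := by
  have key : Integrable (Function.uncurry Z) ((volume.restrict (Set.Ioc s t)).prod P) := by
    rw [integrable_prod_iff hZ.aestronglyMeasurable]
    refine ⟨(ae_restrict_iff' measurableSet_Ioc).2 (Eventually.of_forall hZint), ?_⟩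
    refine Measure.integrableOn_of_bounded (M := C) (by simp) ?_ ?_
    · exact hZ.stronglyMeasurable.norm.integral_prod_right'.aestronglyMeasurable
    · refine (ae_restrict_iff' measurableSet_Ioc).2 (Eventually.of_forall fun r hr => ?_)
      rw [Real.norm_of_nonneg (by positivity)]
      exact hC r hr
  have sw : ∫ ω, (∫ r in Set.Ioc s t, Z r ω) ∂P = ∫ r in Set.Ioc s t, (∫ ω, Z r ω ∂P) :=
    (integral_integral_swap (f := Z) key).symm
  refine ⟨key.integral_prod_right, sw, ?_, key.prod_left_ae⟩
  rw [sw]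
  have := norm_setIntegral_le_of_norm_le_const (μ := volume) (s := Set.Ioc s t) (C := C)
    (f := fun r => ∫ ω, Z r ω ∂P) (by simp)
    (fun r hr => (norm_integral_le_integral_norm _).trans (hC r hr))
  simpa [Measure.real, hst] using this

lemma integral_mul_eq_zero_of_condExp {m' : MeasurableSpace Ω} (hm : m' ≤ m) (f g : Ω → ℝ)
    (hf : StronglyMeasurable[m'] f) (hfg : Integrable (fun ω => f ω * g ω) P) (hg : Integrable g P)
    (h0 : P[g|m'] =ᵐ[P] 0) : ∫ ω, f ω * g ω ∂P = 0 := by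
  have h1 := condExp_mul_of_stronglyMeasurable_left (μ := P) hf hfg hg
  rw [← integral_condExp hm (f := fun ω => f ω * g ω)]
  have : P[fun ω => f ω * g ω|m'] =ᵐ[P] 0 := by
    refine h1.trans ?_
    filter_upwards [h0] with ω hω
    simp [hω]
  rw [integral_congr_ae this]; simp

lemma mart_incr {ℱ : Filtration ℝ m} {M : ℝ → Ω → ℝ} (hM : Martingale M ℱ P) {s t : ℝ} (hst : s ≤ t) :
    P[fun ω => M t ω - M s ω|ℱ s] =ᵐ[P] 0 := by
  have h := condExp_sub (μ := P) (m := ℱ s) (hM.integrable t) (hM.integrable s)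
  refine h.trans ?_
  filter_upwards [hM.condExp_ae_eq hst, hM.condExp_ae_eq (le_refl s)] with ω h1 h2
  simp [h1, h2]

lemma sq_setIntegral_le (f : ℝ → ℝ) (s t : ℝ) (hst : s ≤ t) (hf : IntegrableOn f (Set.Ioc s t))
    (hf2 : IntegrableOn (fun r => f r ^ 2) (Set.Ioc s t)) :
    (∫ r in Set.Ioc s t, f r) ^ 2 ≤ (t - s) * ∫ r in Set.Ioc s t, f r ^ 2 := by
  rcases hst.eq_or_lt with rfl | hlt
  · simp
  set I := ∫ r in Set.Ioc s t, f r with hI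
  have h0 : 0 ≤ ∫ r in Set.Ioc s t, ((t - s) * f r - I) ^ 2 := integral_nonneg fun r => sq_nonneg _
  have hc : IntegrableOn (fun _ : ℝ => I ^ 2) (Set.Ioc s t) := integrableOn_const (by simp)
  have e : ∫ r in Set.Ioc s t, ((t - s) * f r - I) ^ 2
      = (t - s) ^ 2 * (∫ r in Set.Ioc s t, f r ^ 2) - 2 * (t - s) * I * I + (t - s) * I ^ 2 := by
    have : (fun r => ((t - s) * f r - I) ^ 2)
        = fun r => ((t - s) ^ 2 * f r ^ 2 - (2 * (t - s) * I) * f r) + I ^ 2 := by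
      funext r; ring
    have a1 : IntegrableOn (fun r => (t - s) ^ 2 * f r ^ 2 - (2 * (t - s) * I) * f r) (Set.Ioc s t) :=
      (hf2.const_mul _).sub (hf.const_mul _)
    rw [this, integral_add a1 hc,
      integral_sub (hf2.const_mul _) (hf.const_mul _), integral_const_mul, integral_const_mul,
      integral_const]
    simp [Measure.real, hst, hI]
  rw [e] at h0
  have hp : 0 < t - s := by linarith
  have h2 : 0 ≤ (t - s) * ((t - s) * (∫ r in Set.Ioc s t, f r ^ 2) - I ^ 2) := by nlinarith
  have := nonneg_of_mul_nonneg_right h2 hp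
  linarith

lemma integral_abs_le_sqrt (f : Ω → ℝ) (hf : MemLp f 2 P) :
    ∫ ω, |f ω| ∂P ≤ Real.sqrt (∫ ω, f ω ^ 2 ∂P) := by
  apply Real.le_sqrt_of_sq_le
  have hi : Integrable (fun ω => |f ω|) P := (hf.integrable one_le_two).abs
  have hi2 : Integrable (fun ω => f ω ^ 2) P := hf.integrable_sq
  set I := ∫ ω, |f ω| ∂P with hI
  have h0 : 0 ≤ ∫ ω, (|f ω| - I) ^ 2 ∂P := integral_nonneg fun r => sq_nonneg _
  have : (fun ω => (|f ω| - I) ^ 2) = fun ω => (f ω ^ 2 - (2 * I) * |f ω|) + I ^ 2 := by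
    funext r; rw [sub_sq, sq_abs]; ring
  have a1 : Integrable (fun ω => f ω ^ 2 - (2 * I) * |f ω|) P := hi2.sub (hi.const_mul _)
  rw [this, integral_add a1 (integrable_const _),
      integral_sub hi2 (hi.const_mul _), integral_const_mul, integral_const] at h0
  simp at h0
  nlinarith

/-- third absolute moment of the standard Gaussian -/
lemma gauss_third : ∃ m3 : ℝ, 0 ≤ m3 ∧ ∀ (h : ℝ), 0 ≤ h →
    ∫ x, |x| ^ 3 ∂(gaussianReal 0 (Real.toNNReal h)) = m3 * (h * Real.sqrt h) := by
  refine ⟨∫ x, |x| ^ 3 ∂(gaussianReal 0 1), by positivity, fun h hh => ?_⟩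
  have e : gaussianReal 0 (Real.toNNReal h) = (gaussianReal 0 1).map (Real.sqrt h * ·) := by
    rw [gaussianReal_map_const_mul]
    congr 1
    · simp
    · ext; simp [hh]
  rw [e, integral_map (by fun_prop) (by fun_prop)]
  have : (fun x => |Real.sqrt h * x| ^ 3) = fun x => (h * Real.sqrt h) * |x| ^ 3 := by
    funext x
    rw [abs_mul, abs_of_nonneg (Real.sqrt_nonneg h), mul_pow]
    congr 1
    rw [pow_succ, Real.sq_sqrt hh]
  rw [this, integral_const_mul, mul_comm]

variable {ℱ : Filtration ℝ m} {W : ℝ → Ω → ℝ}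

lemma bm_meas (hW : IsBrownianMotion P ℱ W) (s t : ℝ) : Measurable (fun ω => W t ω - W s ω) :=
  ((hW.adapted t).mono (ℱ.le t) le_rfl).sub ((hW.adapted s).mono (ℱ.le s) le_rfl)

lemma bm_memLp (hW : IsBrownianMotion P ℱ W) {s t : ℝ} (hs : 0 ≤ s) (hst : s ≤ t) (p : NNReal) :
    MemLp (fun ω => W t ω - W s ω) p P := by
  have h := memLp_id_gaussianReal (μ := 0) (v := Real.toNNReal (t - s)) p
  rw [← hW.gaussian_increments s t hs hst] at h
  exact (memLp_map_measure_iff aestronglyMeasurable_id (bm_meas hW s t).aemeasurable).1 h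

lemma bm_integral (hW : IsBrownianMotion P ℱ W) {s t : ℝ} (hs : 0 ≤ s) (hst : s ≤ t) (f : ℝ → ℝ)
    (hf : Continuous f) : ∫ ω, f (W t ω - W s ω) ∂P
      = ∫ x, f x ∂(gaussianReal 0 (Real.toNNReal (t - s))) := by
  rw [← hW.gaussian_increments s t hs hst, integral_map (bm_meas hW s t).aemeasurable
    hf.aestronglyMeasurable]

lemma bm_mean (hW : IsBrownianMotion P ℱ W) {s t : ℝ} (hs : 0 ≤ s) (hst : s ≤ t) :
    ∫ ω, (W t ω - W s ω) ∂P = 0 := by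
  rw [bm_integral hW hs hst (fun x => x) continuous_id, integral_id_gaussianReal]

lemma bm_sq (hW : IsBrownianMotion P ℱ W) {s t : ℝ} (hs : 0 ≤ s) (hst : s ≤ t) :
    ∫ ω, (W t ω - W s ω) ^ 2 ∂P = t - s := by
  rw [bm_integral hW hs hst (fun x => x ^ 2) (by fun_prop)]
  have := variance_id_gaussianReal (μ := 0) (v := Real.toNNReal (t - s))
  rw [variance_eq_integral (by fun_prop)] at this
  simp [integral_id_gaussianReal] at this
  rw [this, max_eq_left (by linarith)]

lemma bm_indep (hW : IsBrownianMotion P ℱ W) {s t : ℝ} (hs : 0 ≤ s) (hst : s ≤ t) (f : Ω → ℝ)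
    (hf : Measurable[ℱ s] f) : IndepFun f (fun ω => W t ω - W s ω) P := by
  rw [IndepFun_iff_Indep]
  exact (indep_of_indep_of_le_right (hW.indep_increments s t hs hst) hf.comap_le).symm

lemma bm_condExp (hW : IsBrownianMotion P ℱ W) {s t : ℝ} (hs : 0 ≤ s) (hst : s ≤ t) :
    P[fun ω => W t ω - W s ω|ℱ s] =ᵐ[P] 0 := by
  have h := condExp_indep_eq (μ := P) (f := fun ω => W t ω - W s ω) (bm_meas hW s t).comap_le (ℱ.le s)
    (Measurable.stronglyMeasurable (comap_measurable _)) (hW.indep_increments s t hs hst)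
  rw [bm_mean hW hs hst] at h
  exact h

/-- Product of an `ℱ s`-measurable variable with a function of the increment. -/
lemma bm_mul (hW : IsBrownianMotion P ℱ W) {s t : ℝ} (hs : 0 ≤ s) (hst : s ≤ t) (f : Ω → ℝ)
    (hf : Measurable[ℱ s] f) (hfi : Integrable f P) (g : ℝ → ℝ) (hg : Continuous g)
    (hgi : Integrable (fun ω => g (W t ω - W s ω)) P) :
    Integrable (fun ω => f ω * g (W t ω - W s ω)) P ∧
    ∫ ω, f ω * g (W t ω - W s ω) ∂P = (∫ ω, f ω ∂P) * ∫ ω, g (W t ω - W s ω) ∂P := by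
  have hi : IndepFun f (fun ω => g (W t ω - W s ω)) P :=
    (bm_indep hW hs hst f hf).comp (φ := id) (ψ := g) measurable_id hg.measurable
  exact ⟨hi.integrable_mul hfi hgi,
    hi.integral_fun_mul_eq_mul_integral hfi.aestronglyMeasurable hgi.aestronglyMeasurable⟩

end generic

set_option linter.unusedSectionVars false

lemma gronwall_path (f a : ℝ → ℝ) (hf : Continuous f) (ha : Continuous a) (B T : ℝ) (hB : 0 ≤ B)
    (hT : 0 ≤ T) (ha0 : ∀ t, 0 ≤ a t)
    (h : ∀ t ∈ Set.Icc 0 T, f t ≤ a t + B * ∫ r in Set.Ioc 0 t, f r) :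
    ∫ r in Set.Ioc 0 T, f r ≤ Real.exp (B * T) * ∫ r in Set.Ioc 0 T, a r := by
  set y : ℝ → ℝ := fun t => ∫ r in (0:ℝ)..t, f r with hy
  set A : ℝ → ℝ := fun t => ∫ r in (0:ℝ)..t, a r with hA
  have dy : ∀ t, HasDerivAt y (f t) t := fun t => (hf.integral_hasStrictDerivAt 0 t).hasDerivAt
  have dA : ∀ t, HasDerivAt A (a t) t := fun t => (ha.integral_hasStrictDerivAt 0 t).hasDerivAt
  have de : ∀ t, HasDerivAt (fun t => Real.exp (-(B * t))) (-B * Real.exp (-(B * t))) t := by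
    intro t
    have : HasDerivAt (fun t : ℝ => -(B * t)) (-(B * 1)) t := ((hasDerivAt_id t).const_mul B).neg
    convert! this.exp using 1
    ring
  have cc : ∀ t, HasDerivAt (fun t => Real.exp (-(B * t)) * y t - A t)
      (-B * Real.exp (-(B * t)) * y t + Real.exp (-(B * t)) * f t - a t) t :=
    fun t => ((de t).mul (dy t)).sub (dA t)
  have anti : AntitoneOn (fun t => Real.exp (-(B * t)) * y t - A t) (Set.Icc 0 T) := by
    refine antitoneOn_of_hasDerivWithinAt_nonpos (convex_Icc 0 T)
      (fun t _ => (cc t).continuousAt.continuousWithinAt) (fun t _ => (cc t).hasDerivWithinAt) ?_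
    intro t ht
    rw [interior_Icc] at ht
    have h1 := h t ⟨ht.1.le, ht.2.le⟩
    rw [← intervalIntegral.integral_of_le ht.1.le] at h1
    change f t ≤ a t + B * y t at h1
    have e0 : 0 < Real.exp (-(B * t)) := Real.exp_pos _
    have e1 : Real.exp (-(B * t)) ≤ 1 := by
      rw [Real.exp_le_one_iff]; nlinarith [ht.1]
    nlinarith [ha0 t, mul_le_mul_of_nonneg_left h1 e0.le, mul_le_mul_of_nonneg_right e1 (ha0 t)]
  have := anti ⟨le_rfl, hT⟩ ⟨hT, le_rfl⟩ hT
  simp only [hy, hA, intervalIntegral.integral_same, mul_zero, sub_zero, sub_nonpos] at this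
  rw [intervalIntegral.integral_of_le hT, intervalIntegral.integral_of_le hT] at this
  have e : Real.exp (B * T) * Real.exp (-(B * T)) = 1 := by
    rw [← Real.exp_add]; simp
  calc ∫ r in Set.Ioc 0 T, f r
      = Real.exp (B * T) * (Real.exp (-(B * T)) * ∫ r in Set.Ioc 0 T, f r) := by
        rw [← mul_assoc, e, one_mul]
    _ ≤ _ := by gcongr

/-- Hypotheses on a solution, in the form used below. -/
structure SolHyp {Ω : Type} [m : MeasurableSpace Ω] (P : Measure Ω)
    (ℱ : Filtration ℝ m) (W : ℝ → Ω → ℝ) (σ : ℝ → ℝ) (c x T B : ℝ) (X M G : ℝ → Ω → ℝ) : Prop where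
  c0 : 0 ≤ c
  T0 : 0 ≤ T
  B0 : 0 ≤ B
  σcont : Continuous σ
  σsq : ∀ y, σ y ^ 2 ≤ c ^ 2 * |y|
  σhold : ∀ y z, (σ y - σ z) ^ 2 ≤ c ^ 2 * |y - z|
  contX : ∀ ω, Continuous fun t => X t ω
  adX : Adapted ℱ X
  contM : ∀ ω, Continuous fun t => M t ω
  martM : Martingale M ℱ P
  M0 : ∀ ω, M 0 ω = 0
  qv : Martingale (fun t ω => M t ω ^ 2 - ∫ s in Set.Ioc (0 : ℝ) t, (σ (X s ω)) ^ 2) ℱ P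
  dr : Martingale (fun t ω => M t ω * W t ω - ∫ s in Set.Ioc (0 : ℝ) t, σ (X s ω)) ℱ P
  measG : Measurable (Function.uncurry G)
  Gint : ∀ ω t, IntegrableOn (fun r => G r ω) (Set.Ioc 0 t)
  Gle : ∀ r ∈ Set.Icc 0 T, ∀ ω, |G r ω| ≤ B * (|X r ω| + 1)
  eq : ∀ t ω, X t ω = x + M t ω + ∫ s in Set.Ioc (0 : ℝ) t, G s ω

section sol
variable {Ω : Type} [m : MeasurableSpace Ω] {P : Measure Ω} [IsProbabilityMeasure P]
variable {ℱ : Filtration ℝ m} {W : ℝ → Ω → ℝ} {σ : ℝ → ℝ} {c x T B : ℝ} {X M G : ℝ → Ω → ℝ}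

lemma SolHyp.measX (H : SolHyp P ℱ W σ c x T B X M G) : Measurable (Function.uncurry X) :=
  measurable_uncurry_of_continuous_of_measurable H.contX
    fun t => (H.adX t).mono (ℱ.le t) le_rfl

lemma SolHyp.measX1 (H : SolHyp P ℱ W σ c x T B X M G) (t : ℝ) : Measurable (X t) :=
  (H.adX t).mono (ℱ.le t) le_rfl

lemma SolHyp.measM1 (H : SolHyp P ℱ W σ c x T B X M G) (t : ℝ) : Measurable (M t) :=
  (H.martM.stronglyMeasurable t).measurable.mono (ℱ.le t) le_rfl

lemma SolHyp.measM (H : SolHyp P ℱ W σ c x T B X M G) : Measurable (Function.uncurry M) :=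
  measurable_uncurry_of_continuous_of_measurable H.contM H.measM1

lemma SolHyp.pathX (H : SolHyp P ℱ W σ c x T B X M G) (ω : Ω) (t : ℝ) (ht : t ∈ Set.Icc 0 T) :
    |X t ω| ≤ (|x| + B * T + |M t ω|) + B * ∫ r in Set.Ioc 0 t, |X r ω| := by
  have hi : IntegrableOn (fun r => |X r ω|) (Set.Ioc 0 t) :=
    ((H.contX ω).abs.integrableOn_Icc).mono_set Set.Ioc_subset_Icc_self
  have hc : IntegrableOn (fun _ : ℝ => (1:ℝ)) (Set.Ioc 0 t) := integrableOn_const (by simp)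
  have h1 : |∫ s in Set.Ioc (0 : ℝ) t, G s ω| ≤ B * (∫ r in Set.Ioc 0 t, |X r ω|) + B * T := by
    calc |∫ s in Set.Ioc (0 : ℝ) t, G s ω| ≤ ∫ s in Set.Ioc (0 : ℝ) t, |G s ω| :=
          abs_integral_le_integral_abs
      _ ≤ ∫ s in Set.Ioc (0 : ℝ) t, B * (|X s ω| + 1) := by
          refine setIntegral_mono_on (H.Gint ω t).abs ((hi.add hc).const_mul B) measurableSet_Ioc ?_
          intro r hr
          exact H.Gle r ⟨hr.1.le, hr.2.trans ht.2⟩ ω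
      _ = B * (∫ r in Set.Ioc 0 t, |X r ω|) + B * t := by
          rw [integral_const_mul, integral_add hi hc]
          simp [Measure.real, ht.1]
          ring
      _ ≤ _ := by
          have := mul_le_mul_of_nonneg_left ht.2 H.B0
          linarith
  rw [H.eq t ω]
  have := abs_add_le (x + M t ω) (∫ s in Set.Ioc (0 : ℝ) t, G s ω)
  have := abs_add_le x (M t ω)
  linarith

lemma SolHyp.pathY (H : SolHyp P ℱ W σ c x T B X M G) (ω : Ω) :
    ∫ r in Set.Ioc 0 T, |X r ω| ≤
      Real.exp (B * T) * ((|x| + B * T) * T + ∫ r in Set.Ioc 0 T, |M r ω|) := by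
  have h := gronwall_path (fun r => |X r ω|) (fun r => |x| + B * T + |M r ω|) (H.contX ω).abs
    (continuous_const.add (H.contM ω).abs) B T H.B0 H.T0
    (fun t => by have := H.B0; have := H.T0; positivity) (fun t ht => H.pathX ω t ht)
  refine h.trans (le_of_eq ?_)
  congr 1
  rw [integral_add (integrable_const _)
    (((H.contM ω).abs.integrableOn_Icc).mono_set Set.Ioc_subset_Icc_self)]
  simp [Measure.real, H.T0]
  ring

lemma SolHyp.Yint (H : SolHyp P ℱ W σ c x T B X M G) :
    Integrable (fun ω => ∫ r in Set.Ioc 0 T, |X r ω|) P := by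
  have hM : Integrable (fun ω => ∫ r in Set.Ioc 0 T, |M r ω|) P := by
    refine (fub (P := P) (fun r ω => |M r ω|) H.measM.abs 0 T (∫ ω, |M T ω| ∂P) H.T0
      (fun r _ => (H.martM.integrable r).abs) ?_).1
    intro r hr
    simp only [abs_abs]
    rw [← integral_congr_ae ((H.martM.condExp_ae_eq hr.2).mono fun ω h => congrArg abs h)]
    exact integral_abs_condExp_le _
  have hb : Integrable (fun ω => Real.exp (B * T) * ((|x| + B * T) * T + ∫ r in Set.Ioc 0 T, |M r ω|)) P :=
    ((integrable_const _).add hM).const_mul _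
  refine hb.mono' ?_ (Eventually.of_forall fun ω => ?_)
  · have : StronglyMeasurable (Function.uncurry fun r ω => |X r ω|) := H.measX.abs.stronglyMeasurable
    exact this.integral_prod_left.aestronglyMeasurable
  · rw [Real.norm_of_nonneg (by positivity)]
    exact H.pathY ω

lemma SolHyp.σint (H : SolHyp P ℱ W σ c x T B X M G) (ω : Ω) (s t : ℝ) :
    IntegrableOn (fun r => σ (X r ω) ^ 2) (Set.Ioc s t) :=
  (((H.σcont.comp (H.contX ω)).pow 2).integrableOn_Icc).mono_set Set.Ioc_subset_Icc_self

lemma SolHyp.σint1 (H : SolHyp P ℱ W σ c x T B X M G) (ω : Ω) (s t : ℝ) :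
    IntegrableOn (fun r => σ (X r ω)) (Set.Ioc s t) :=
  (((H.σcont.comp (H.contX ω))).integrableOn_Icc).mono_set Set.Ioc_subset_Icc_self

lemma SolHyp.Q (H : SolHyp P ℱ W σ c x T B X M G) (t : ℝ) (ht : t ∈ Set.Icc 0 T) :
    Integrable (fun ω => ∫ r in Set.Ioc 0 t, σ (X r ω) ^ 2) P ∧
    ∫ ω, (∫ r in Set.Ioc 0 t, σ (X r ω) ^ 2) ∂P ≤ c ^ 2 * ∫ ω, (∫ r in Set.Ioc 0 T, |X r ω|) ∂P := by
  have hb : ∀ ω, ∫ r in Set.Ioc 0 t, σ (X r ω) ^ 2 ≤ c ^ 2 * ∫ r in Set.Ioc 0 T, |X r ω| := by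
    intro ω
    have hi : IntegrableOn (fun r => |X r ω|) (Set.Ioc 0 T) :=
      ((H.contX ω).abs.integrableOn_Icc).mono_set Set.Ioc_subset_Icc_self
    calc ∫ r in Set.Ioc 0 t, σ (X r ω) ^ 2 ≤ ∫ r in Set.Ioc 0 T, σ (X r ω) ^ 2 :=
          setIntegral_mono_set (H.σint ω 0 T) (Eventually.of_forall fun r => sq_nonneg _)
            (Set.Ioc_subset_Ioc_right ht.2).eventuallyLE
      _ ≤ ∫ r in Set.Ioc 0 T, c ^ 2 * |X r ω| :=
          setIntegral_mono (H.σint ω 0 T) (hi.const_mul _) (fun r => H.σsq _)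
      _ = _ := integral_const_mul _ _
  have hY := H.Yint.const_mul (c ^ 2)
  have h1 : Integrable (fun ω => ∫ r in Set.Ioc 0 t, σ (X r ω) ^ 2) P := by
    refine hY.mono' ?_ (Eventually.of_forall fun ω => ?_)
    · have : StronglyMeasurable (Function.uncurry fun r ω => σ (X r ω) ^ 2) :=
        ((H.σcont.measurable.comp H.measX).pow_const 2).stronglyMeasurable
      exact this.integral_prod_left.aestronglyMeasurable
    · rw [Real.norm_of_nonneg (by positivity)]
      exact hb ω
  refine ⟨h1, ?_⟩
  rw [← integral_const_mul]
  exact integral_mono h1 hY hb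

lemma SolHyp.ML2 (H : SolHyp P ℱ W σ c x T B X M G) (t : ℝ) (ht : t ∈ Set.Icc 0 T) :
    MemLp (M t) 2 P := by
  rw [memLp_two_iff_integrable_sq (H.measM1 t).aestronglyMeasurable]
  have := (H.qv.integrable t).add (H.Q t ht).1
  refine this.congr (Eventually.of_forall fun ω => ?_)
  simp

/-- Isometry. -/
lemma SolHyp.iso0 (H : SolHyp P ℱ W σ c x T B X M G) (t : ℝ) (ht : t ∈ Set.Icc 0 T) :
    ∫ ω, M t ω ^ 2 ∂P = ∫ ω, (∫ r in Set.Ioc 0 t, σ (X r ω) ^ 2) ∂P := by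
  have h1 := integral_congr_ae (H.qv.condExp_ae_eq ht.1)
  rw [integral_condExp (ℱ.le 0)] at h1
  simp only [H.M0, Set.Ioc_self, Measure.restrict_empty, integral_zero_measure] at h1
  rw [integral_sub (H.ML2 t ht).integrable_sq (H.Q t ht).1] at h1
  simp at h1
  linarith

lemma SolHyp.XL2 (H : SolHyp P ℱ W σ c x T B X M G) : ∃ C, 0 ≤ C ∧ ∀ t ∈ Set.Icc 0 T,
    MemLp (X t) 2 P ∧ ∫ ω, X t ω ^ 2 ∂P ≤ C := by
  set q := c ^ 2 * ∫ ω, (∫ r in Set.Ioc 0 T, |X r ω|) ∂P with hq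
  have hMq : ∀ t ∈ Set.Icc 0 T, ∫ ω, M t ω ^ 2 ∂P ≤ q := fun t ht => by
    rw [H.iso0 t ht]; exact (H.Q t ht).2
  have hM2 := fub (P := P) (fun r ω => M r ω ^ 2) (H.measM.pow_const 2) 0 T q H.T0
      (fun r hr => (H.ML2 r ⟨hr.1.le, hr.2⟩).integrable_sq)
      (fun r hr => by simpa using hMq r ⟨hr.1.le, hr.2⟩)
  set Y : Ω → ℝ := fun ω => ∫ r in Set.Ioc 0 T, |X r ω| with hYd
  set e := Real.exp (B * T) with he
  have he0 : 0 ≤ e := (Real.exp_pos _).le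
  have Ynn : ∀ ω, 0 ≤ Y ω := fun ω => by simp only [hYd]; positivity
  have Ysq : ∀ ω, Y ω ^ 2 ≤ 2 * e ^ 2 * (((|x| + B * T) * T) ^ 2 + T * ∫ r in Set.Ioc 0 T, M r ω ^ 2) := by
    intro ω
    have h1 := H.pathY ω
    have hi : IntegrableOn (fun r => |M r ω|) (Set.Ioc 0 T) :=
      ((H.contM ω).abs.integrableOn_Icc).mono_set Set.Ioc_subset_Icc_self
    have hi2 : IntegrableOn (fun r => |M r ω| ^ 2) (Set.Ioc 0 T) :=
      (((H.contM ω).abs.pow 2).integrableOn_Icc).mono_set Set.Ioc_subset_Icc_self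
    have h2 := sq_setIntegral_le _ 0 T H.T0 hi hi2
    simp only [sq_abs, sub_zero] at h2
    have h3 : Y ω ^ 2 ≤ (e * ((|x| + B * T) * T + ∫ r in Set.Ioc 0 T, |M r ω|)) ^ 2 :=
      pow_le_pow_left₀ (Ynn ω) h1 2
    refine h3.trans ?_
    rw [mul_pow, mul_comm 2, mul_assoc]
    refine mul_le_mul_of_nonneg_left ?_ (by positivity)
    nlinarith [sq_nonneg ((|x| + B * T) * T - ∫ r in Set.Ioc 0 T, |M r ω|)]
  have hbi : Integrable (fun ω => 2 * e ^ 2 * (((|x| + B * T) * T) ^ 2 + T * ∫ r in Set.Ioc 0 T, M r ω ^ 2)) P :=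
    ((integrable_const _).add (hM2.1.const_mul _)).const_mul _
  have Y2 : Integrable (fun ω => Y ω ^ 2) P := by
    refine hbi.mono' (H.Yint.aestronglyMeasurable.pow 2) (Eventually.of_forall fun ω => ?_)
    rw [Real.norm_of_nonneg (sq_nonneg _)]
    exact Ysq ω
  have Xsq : ∀ t ∈ Set.Icc 0 T, ∀ ω, X t ω ^ 2 ≤ 3 * ((|x| + B * T) ^ 2 + M t ω ^ 2 + B ^ 2 * Y ω ^ 2) := by
    intro t ht ω
    have h1 := H.pathX ω t ht
    have h2 : ∫ r in Set.Ioc 0 t, |X r ω| ≤ Y ω :=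
      setIntegral_mono_set (((H.contX ω).abs.integrableOn_Icc).mono_set Set.Ioc_subset_Icc_self)
        (Eventually.of_forall fun r => abs_nonneg _) (Set.Ioc_subset_Ioc_right ht.2).eventuallyLE
    have h3 : |X t ω| ≤ (|x| + B * T) + |M t ω| + B * Y ω := by
      have := mul_le_mul_of_nonneg_left h2 H.B0
      linarith
    have h4 := pow_le_pow_left₀ (abs_nonneg _) h3 2
    rw [sq_abs] at h4
    have h5 := sq_abs (M t ω)
    nlinarith [sq_nonneg ((|x| + B * T) - |M t ω|), sq_nonneg ((|x| + B * T) - B * Y ω),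
      sq_nonneg (|M t ω| - B * Y ω)]
  refine ⟨3 * ((|x| + B * T) ^ 2 + q + B ^ 2 * ∫ ω, Y ω ^ 2 ∂P), ?_, fun t ht => ?_⟩
  · have : 0 ≤ q := (integral_nonneg fun ω => sq_nonneg _).trans (hMq 0 ⟨le_rfl, H.T0⟩)
    have : 0 ≤ ∫ ω, Y ω ^ 2 ∂P := integral_nonneg fun ω => sq_nonneg _
    positivity
  have i1 : Integrable (fun ω => (|x| + B * T) ^ 2 + M t ω ^ 2) P :=
    (integrable_const _).add (H.ML2 t ht).integrable_sq
  have i2 : Integrable (fun ω => (|x| + B * T) ^ 2 + M t ω ^ 2 + B ^ 2 * Y ω ^ 2) P :=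
    i1.add (Y2.const_mul _)
  have i3 : Integrable (fun ω => X t ω ^ 2) P := by
    refine (i2.const_mul 3).mono' ((H.measX1 t).pow_const 2).aestronglyMeasurable
      (Eventually.of_forall fun ω => ?_)
    rw [Real.norm_of_nonneg (sq_nonneg _)]
    exact Xsq t ht ω
  refine ⟨(memLp_two_iff_integrable_sq (H.measX1 t).aestronglyMeasurable).2 i3, ?_⟩
  refine (integral_mono i3 (i2.const_mul 3) (Xsq t ht)).trans ?_
  rw [integral_const_mul, integral_add i1 (Y2.const_mul _),
    integral_add (integrable_const _) (H.ML2 t ht).integrable_sq, integral_const_mul]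
  simp only [integral_const, probReal_univ, smul_eq_mul, one_mul]
  have := hMq t ht
  linarith
end sol

set_option linter.unusedSectionVars false

section incr
variable {Ω : Type} [m : MeasurableSpace Ω] {P : Measure Ω} [IsProbabilityMeasure P]
variable {ℱ : Filtration ℝ m} {W : ℝ → Ω → ℝ} {σ : ℝ → ℝ} {c x T B : ℝ} {X M G : ℝ → Ω → ℝ}

lemma condExp_mul_zero {m' : MeasurableSpace Ω} (f g : Ω → ℝ)
    (hf : StronglyMeasurable[m'] f) (hfg : Integrable (fun ω => f ω * g ω) P) (hg : Integrable g P)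
    (h0 : P[g|m'] =ᵐ[P] 0) : P[fun ω => f ω * g ω|m'] =ᵐ[P] 0 := by
  have h1 := condExp_mul_of_stronglyMeasurable_left (μ := P) hf hfg hg
  refine h1.trans ?_
  filter_upwards [h0] with ω hω
  simp [hω]

lemma Ioc_split (f : ℝ → ℝ) (s t : ℝ) (hs : 0 ≤ s) (hst : s ≤ t) (hf : IntegrableOn f (Set.Ioc 0 t)) :
    ∫ r in Set.Ioc 0 t, f r = (∫ r in Set.Ioc 0 s, f r) + ∫ r in Set.Ioc s t, f r := by
  rw [← Set.Ioc_union_Ioc_eq_Ioc hs hst, setIntegral_union (Set.Ioc_disjoint_Ioc_of_le le_rfl)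
    measurableSet_Ioc (hf.mono_set (Set.Ioc_subset_Ioc_right hst))
    (hf.mono_set (Set.Ioc_subset_Ioc_left hs))]

lemma SolHyp.eqIncr (H : SolHyp P ℱ W σ c x T B X M G) (s t : ℝ) (hs : 0 ≤ s) (hst : s ≤ t) (ω : Ω) :
    X t ω - X s ω = (M t ω - M s ω) + ∫ r in Set.Ioc s t, G r ω := by
  rw [H.eq t ω, H.eq s ω, Ioc_split _ s t hs hst (H.Gint ω t)]
  ring

lemma SolHyp.σL2 (H : SolHyp P ℱ W σ c x T B X M G) {C : ℝ} {t : ℝ}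
    (hX : MemLp (X t) 2 P) (hC : ∫ ω, X t ω ^ 2 ∂P ≤ C) :
    MemLp (fun ω => σ (X t ω)) 2 P ∧ ∫ ω, σ (X t ω) ^ 2 ∂P ≤ c ^ 2 * (1 + C) := by
  have hm : Measurable (fun ω => σ (X t ω)) := H.σcont.measurable.comp (H.measX1 t)
  have hb : ∀ ω, σ (X t ω) ^ 2 ≤ c ^ 2 * (1 + X t ω ^ 2) := fun ω => by
    refine (H.σsq _).trans (mul_le_mul_of_nonneg_left ?_ (sq_nonneg c))
    nlinarith [sq_abs (X t ω), sq_nonneg (|X t ω| - 1), abs_nonneg (X t ω)]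
  have hi : Integrable (fun ω => c ^ 2 * (1 + X t ω ^ 2)) P :=
    ((integrable_const _).add hX.integrable_sq).const_mul _
  have h2 : Integrable (fun ω => σ (X t ω) ^ 2) P := by
    refine hi.mono' (hm.pow_const 2).aestronglyMeasurable (Eventually.of_forall fun ω => ?_)
    rw [Real.norm_of_nonneg (sq_nonneg _)]
    exact hb ω
  refine ⟨(memLp_two_iff_integrable_sq hm.aestronglyMeasurable).2 h2, ?_⟩
  refine (integral_mono h2 hi hb).trans ?_
  rw [integral_const_mul, integral_add (integrable_const _) hX.integrable_sq]
  simp only [integral_const, probReal_univ, smul_eq_mul, one_mul]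
  gcongr

lemma SolHyp.incr (H : SolHyp P ℱ W σ c x T B X M G) (hW : IsBrownianMotion P ℱ W) :
    ∃ C, 0 ≤ C ∧ (∀ t ∈ Set.Icc 0 T, MemLp (X t) 2 P ∧ ∫ ω, X t ω ^ 2 ∂P ≤ C) ∧
    ∀ s t, 0 ≤ s → s ≤ t → t ≤ T →
      (MemLp (fun ω => ∫ r in Set.Ioc s t, G r ω) 2 P ∧
        ∫ ω, (∫ r in Set.Ioc s t, G r ω) ^ 2 ∂P ≤ C * (t - s) ^ 2) ∧
      ∫ ω, (X t ω - X s ω) ^ 2 ∂P ≤ C * (t - s) ∧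
      (MemLp (fun ω => M t ω - M s ω - σ (X s ω) * (W t ω - W s ω)) 2 P ∧
        ∫ ω, (M t ω - M s ω - σ (X s ω) * (W t ω - W s ω)) ^ 2 ∂P ≤ C * ((t - s) * Real.sqrt (t - s))) := by
  obtain ⟨C, C0, hC⟩ := H.XL2
  have hσ := fun t ht => H.σL2 (hC t ht).1 (hC t ht).2
  set C1 := 2 * B ^ 2 * (C + 1) with hC1
  set C2 := 2 * (c ^ 2 * (1 + C)) + 2 * C1 * T with hC2
  set C3 := c ^ 2 * Real.sqrt C2 with hC3
  have C10 : 0 ≤ C1 := by positivity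
  have C20 : 0 ≤ C2 := by have := H.T0; positivity
  have C30 : 0 ≤ C3 := by positivity
  -- drift part
  have hA : ∀ s t, 0 ≤ s → s ≤ t → t ≤ T → (MemLp (fun ω => ∫ r in Set.Ioc s t, G r ω) 2 P ∧
        ∫ ω, (∫ r in Set.Ioc s t, G r ω) ^ 2 ∂P ≤ C1 * (t - s) ^ 2) := by
    intro s t hs hst htT
    have hf : ∀ r ∈ Set.Ioc s t, Integrable (fun ω => (B * (|X r ω| + 1)) ^ 2) P ∧
        ∫ ω, (B * (|X r ω| + 1)) ^ 2 ∂P ≤ C1 := by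
      intro r hr
      have hr' : r ∈ Set.Icc 0 T := ⟨hs.trans hr.1.le, hr.2.trans htT⟩
      have hb : ∀ ω, (B * (|X r ω| + 1)) ^ 2 ≤ 2 * B ^ 2 * (X r ω ^ 2 + 1) := fun ω => by
        rw [mul_pow, mul_comm 2, mul_assoc]
        refine mul_le_mul_of_nonneg_left ?_ (sq_nonneg B)
        nlinarith [sq_abs (X r ω), sq_nonneg (|X r ω| - 1)]
      have hi : Integrable (fun ω => 2 * B ^ 2 * (X r ω ^ 2 + 1)) P :=
        ((hC r hr').1.integrable_sq.add (integrable_const _)).const_mul _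
      have hi' : Integrable (fun ω => (B * (|X r ω| + 1)) ^ 2) P := by
        refine hi.mono' ?_ (Eventually.of_forall fun ω => ?_)
        · exact ((((H.measX1 r).abs.add_const 1).const_mul B).pow_const 2).aestronglyMeasurable
        · rw [Real.norm_of_nonneg (sq_nonneg _)]
          exact hb ω
      refine ⟨hi', (integral_mono hi' hi hb).trans ?_⟩
      rw [integral_const_mul, integral_add (hC r hr').1.integrable_sq (integrable_const _)]
      simp only [integral_const, probReal_univ, smul_eq_mul, mul_one]
      rw [hC1]
      have := (hC r hr').2
      gcongr
    have F := fub (P := P) (fun r ω => (B * (|X r ω| + 1)) ^ 2)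
      (((H.measX.abs.add_const 1).const_mul B).pow_const 2) s t C1 hst (fun r hr => (hf r hr).1)
      (fun r hr => by simpa only [abs_sq] using (hf r hr).2)
    have hAb : ∀ ω, (∫ r in Set.Ioc s t, G r ω) ^ 2 ≤
        (t - s) * ∫ r in Set.Ioc s t, (B * (|X r ω| + 1)) ^ 2 := by
      intro ω
      have hc : Continuous fun r => B * (|X r ω| + 1) :=
        continuous_const.mul ((H.contX ω).abs.add continuous_const)
      have i1 : IntegrableOn (fun r => B * (|X r ω| + 1)) (Set.Ioc s t) :=
        hc.integrableOn_Icc.mono_set Set.Ioc_subset_Icc_self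
      have i2 : IntegrableOn (fun r => (B * (|X r ω| + 1)) ^ 2) (Set.Ioc s t) :=
        (hc.pow 2).integrableOn_Icc.mono_set Set.Ioc_subset_Icc_self
      refine le_trans ?_ (sq_setIntegral_le _ s t hst i1 i2)
      rw [← sq_abs]
      refine pow_le_pow_left₀ (abs_nonneg _) ?_ 2
      refine abs_integral_le_integral_abs.trans ?_
      refine setIntegral_mono_on (((H.Gint ω t).mono_set (Set.Ioc_subset_Ioc_left hs)).abs) i1
        measurableSet_Ioc ?_
      intro r hr
      exact H.Gle r ⟨hs.trans hr.1.le, hr.2.trans htT⟩ ω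
    have hm : StronglyMeasurable (fun ω => ∫ r in Set.Ioc s t, G r ω) := by
      have : StronglyMeasurable (Function.uncurry G) := H.measG.stronglyMeasurable
      exact this.integral_prod_left
    have hi : Integrable (fun ω => (∫ r in Set.Ioc s t, G r ω) ^ 2) P := by
      refine (F.1.const_mul (t - s)).mono' (hm.pow 2).aestronglyMeasurable
        (Eventually.of_forall fun ω => ?_)
      rw [Real.norm_of_nonneg (sq_nonneg _)]
      exact hAb ω
    refine ⟨(memLp_two_iff_integrable_sq hm.aestronglyMeasurable).2 hi, ?_⟩
    refine (integral_mono hi (F.1.const_mul (t - s)) hAb).trans ?_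
    rw [integral_const_mul]
    have h1 := (abs_le.1 F.2.2.1).2
    have := mul_le_mul_of_nonneg_left h1 (sub_nonneg.2 hst)
    linarith
  -- martingale part
  have hQ : ∀ s t, 0 ≤ s → s ≤ t → t ≤ T →
      Integrable (fun ω => ∫ r in Set.Ioc s t, σ (X r ω) ^ 2) P ∧
      ∫ ω, (∫ r in Set.Ioc s t, σ (X r ω) ^ 2) ∂P ≤ c ^ 2 * (1 + C) * (t - s) := by
    intro s t hs hst htT
    have F := fub (P := P) (fun r ω => σ (X r ω) ^ 2)
      ((H.σcont.measurable.comp H.measX).pow_const 2) s t (c ^ 2 * (1 + C)) hst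
      (fun r hr => (hσ r ⟨hs.trans hr.1.le, hr.2.trans htT⟩).1.integrable_sq)
      (fun r hr => by
        simpa only [abs_sq] using (hσ r ⟨hs.trans hr.1.le, hr.2.trans htT⟩).2)
    exact ⟨F.1, (abs_le.1 F.2.2.1).2⟩
  have hΔM : ∀ s t, 0 ≤ s → s ≤ t → t ≤ T → MemLp (fun ω => M t ω - M s ω) 2 P ∧
      ∫ ω, (M t ω - M s ω) ^ 2 ∂P = ∫ ω, (∫ r in Set.Ioc s t, σ (X r ω) ^ 2) ∂P := by
    intro s t hs hst htT
    have ht : t ∈ Set.Icc 0 T := ⟨hs.trans hst, htT⟩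
    have hs' : s ∈ Set.Icc 0 T := ⟨hs, hst.trans htT⟩
    have L1 := H.ML2 t ht
    have L2 := H.ML2 s hs'
    have L3 : MemLp (fun ω => M t ω - M s ω) 2 P := L1.sub L2
    refine ⟨L3, ?_⟩
    have ii : Integrable (fun ω => M s ω * (M t ω - M s ω)) P := L2.integrable_mul L3
    have z := integral_mul_eq_zero_of_condExp (P := P) (ℱ.le s) (M s) (fun ω => M t ω - M s ω)
      (H.martM.stronglyMeasurable s) ii (L3.integrable one_le_two) (mart_incr H.martM hst)
    have e : (fun ω => (M t ω - M s ω) ^ 2)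
        = fun ω => (M t ω ^ 2 - M s ω ^ 2) - 2 * (M s ω * (M t ω - M s ω)) := by
      funext ω; ring
    have i4 : Integrable (fun ω => M t ω ^ 2 - M s ω ^ 2) P := L1.integrable_sq.sub L2.integrable_sq
    rw [e, integral_sub i4 (ii.const_mul 2), integral_const_mul, z,
      integral_sub L1.integrable_sq L2.integrable_sq, H.iso0 t ht, H.iso0 s hs']
    have e2 : (fun ω => ∫ r in Set.Ioc 0 t, σ (X r ω) ^ 2)
        = fun ω => (∫ r in Set.Ioc 0 s, σ (X r ω) ^ 2) + ∫ r in Set.Ioc s t, σ (X r ω) ^ 2 := by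
      funext ω
      exact Ioc_split _ s t hs hst (H.σint ω 0 t)
    rw [e2, integral_add (H.Q s hs').1 (hQ s t hs hst htT).1]
    ring
  have hX : ∀ s t, 0 ≤ s → s ≤ t → t ≤ T → ∫ ω, (X t ω - X s ω) ^ 2 ∂P ≤ C2 * (t - s) := by
    intro s t hs hst htT
    have a := hA s t hs hst htT
    have b := hΔM s t hs hst htT
    have hb : ∀ ω, (X t ω - X s ω) ^ 2 ≤ 2 * (M t ω - M s ω) ^ 2 + 2 * (∫ r in Set.Ioc s t, G r ω) ^ 2 := by
      intro ω
      rw [H.eqIncr s t hs hst ω]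
      nlinarith [sq_nonneg ((M t ω - M s ω) - ∫ r in Set.Ioc s t, G r ω)]
    have i0 : MemLp (fun ω => X t ω - X s ω) 2 P :=
      (hC t ⟨hs.trans hst, htT⟩).1.sub (hC s ⟨hs, hst.trans htT⟩).1
    have i5 : Integrable (fun ω => 2 * (M t ω - M s ω) ^ 2 + 2 * (∫ r in Set.Ioc s t, G r ω) ^ 2) P :=
      (b.1.integrable_sq.const_mul 2).add (a.1.integrable_sq.const_mul 2)
    refine (integral_mono i0.integrable_sq i5 hb).trans ?_
    rw [integral_add (b.1.integrable_sq.const_mul 2) (a.1.integrable_sq.const_mul 2),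
      integral_const_mul, integral_const_mul, b.2]
    have h1 := (hQ s t hs hst htT).2
    have h2 := a.2
    have h3 : C1 * (t - s) ^ 2 ≤ C1 * T * (t - s) := by
      rw [sq, ← mul_assoc]
      have : t - s ≤ T := by linarith
      have : 0 ≤ t - s := by linarith
      gcongr
    rw [hC2]
    nlinarith
  -- remainder
  have hR : ∀ s t, 0 ≤ s → s ≤ t → t ≤ T →
      (MemLp (fun ω => M t ω - M s ω - σ (X s ω) * (W t ω - W s ω)) 2 P ∧
        ∫ ω, (M t ω - M s ω - σ (X s ω) * (W t ω - W s ω)) ^ 2 ∂P ≤ C3 * ((t - s) * Real.sqrt (t - s))) := by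
    intro s t hs hst htT
    have ht : t ∈ Set.Icc 0 T := ⟨hs.trans hst, htT⟩
    have hs' : s ∈ Set.Icc 0 T := ⟨hs, hst.trans htT⟩
    have sL := (hσ s hs').1
    have sm : Measurable[ℱ s] (fun ω => σ (X s ω)) := H.σcont.measurable.comp (H.adX s)
    have dW : MemLp (fun ω => W t ω - W s ω) 2 P := bm_memLp hW hs hst 2
    have dM := (hΔM s t hs hst htT).1
    have uu := bm_mul hW hs hst (fun ω => σ (X s ω) ^ 2) (sm.pow_const 2) sL.integrable_sq
      (fun x => x ^ 2) (by fun_prop) dW.integrable_sq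
    have uL : MemLp (fun ω => σ (X s ω) * (W t ω - W s ω)) 2 P := by
      rw [memLp_two_iff_integrable_sq]
      · simpa only [mul_pow] using uu.1
      · exact sL.1.mul dW.1
    have RL : MemLp (fun ω => M t ω - M s ω - σ (X s ω) * (W t ω - W s ω)) 2 P := dM.sub uL
    refine ⟨RL, ?_⟩
    set S : Ω → ℝ := fun ω => ∫ r in Set.Ioc s t, σ (X r ω) with hS
    have SL : MemLp S 2 P := by
      have hm : StronglyMeasurable S := by
        have : StronglyMeasurable (Function.uncurry fun r ω => σ (X r ω)) :=
          (H.σcont.measurable.comp H.measX).stronglyMeasurable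
        exact this.integral_prod_left
      rw [memLp_two_iff_integrable_sq hm.aestronglyMeasurable]
      refine ((hQ s t hs hst htT).1.const_mul (t - s)).mono' (hm.pow 2).aestronglyMeasurable
        (Eventually.of_forall fun ω => ?_)
      rw [Real.norm_of_nonneg (sq_nonneg _)]
      exact sq_setIntegral_le _ s t hst (H.σint1 ω s t) (H.σint ω s t)
    -- cross term
    have Ws : ∀ r, 0 ≤ r → MemLp (W r) 2 P := fun r hr => by
      have h2 : MemLp (fun ω => W r ω - W 0 ω) 2 P := bm_memLp hW le_rfl hr 2
      simp only [hW.start, sub_zero] at h2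
      exact h2
    have g0 : P[fun ω => (M t ω - M s ω) * (W t ω - W s ω) - S ω|ℱ s] =ᵐ[P] 0 := by
      have e : (fun ω => (M t ω - M s ω) * (W t ω - W s ω) - S ω)
          = ((fun ω => (M t ω * W t ω - ∫ s in Set.Ioc (0 : ℝ) t, σ (X s ω))
            - (M s ω * W s ω - ∫ s in Set.Ioc (0 : ℝ) s, σ (X s ω)))
            - (fun ω => M s ω * (W t ω - W s ω))) - (fun ω => W s ω * (M t ω - M s ω)) := by
        funext ω
        simp only [Pi.sub_apply, hS]
        rw [Ioc_split _ s t hs hst (H.σint1 ω 0 t)]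
        ring
      have i1 : Integrable (fun ω => (M t ω * W t ω - ∫ s in Set.Ioc (0 : ℝ) t, σ (X s ω))
            - (M s ω * W s ω - ∫ s in Set.Ioc (0 : ℝ) s, σ (X s ω))) P :=
        (H.dr.integrable t).sub (H.dr.integrable s)
      have i2 : Integrable (fun ω => M s ω * (W t ω - W s ω)) P := (H.ML2 s hs').integrable_mul dW
      have i3 : Integrable (fun ω => W s ω * (M t ω - M s ω)) P := (Ws s hs).integrable_mul dM
      rw [e]
      refine (condExp_sub (i1.sub i2) i3 _).trans ?_
      have z1 := mart_incr H.dr hst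
      have z2 := condExp_mul_zero (P := P) (m' := ℱ s) (M s) (fun ω => W t ω - W s ω)
        (H.martM.stronglyMeasurable s) i2 (dW.integrable one_le_two) (bm_condExp hW hs hst)
      have z3 := condExp_mul_zero (P := P) (m' := ℱ s) (W s) (fun ω => M t ω - M s ω)
        (hW.adapted s).stronglyMeasurable i3 (dM.integrable one_le_two) (mart_incr H.martM hst)
      filter_upwards [condExp_sub (m := ℱ s) i1 i2, z1, z2, z3] with ω h1 h2 h3 h4
      simp only [Pi.sub_apply, Pi.zero_apply] at *
      rw [h1, h2, h3, h4]; simp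
    have gi : Integrable (fun ω => (M t ω - M s ω) * (W t ω - W s ω) - S ω) P :=
      (dM.integrable_mul dW).sub (SL.integrable one_le_two)
    have c1 : Integrable (fun ω => (M t ω - M s ω) * (σ (X s ω) * (W t ω - W s ω))) P :=
      dM.integrable_mul uL
    have c2 : Integrable (fun ω => σ (X s ω) * S ω) P := sL.integrable_mul SL
    have cross : ∫ ω, (M t ω - M s ω) * (σ (X s ω) * (W t ω - W s ω)) ∂P = ∫ ω, σ (X s ω) * S ω ∂P := by
      have e : (fun ω => σ (X s ω) * ((M t ω - M s ω) * (W t ω - W s ω) - S ω))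
          = fun ω => (M t ω - M s ω) * (σ (X s ω) * (W t ω - W s ω)) - σ (X s ω) * S ω := by
        funext ω; ring
      have := integral_mul_eq_zero_of_condExp (P := P) (ℱ.le s) (fun ω => σ (X s ω)) _
        sm.stronglyMeasurable (by rw [e]; exact c1.sub c2) gi g0
      rw [e, integral_sub c1 c2] at this
      linarith
    have hZ : ∀ r ∈ Set.Ioc s t, Integrable (fun ω => (σ (X r ω) - σ (X s ω)) ^ 2) P ∧
        ∫ ω, (σ (X r ω) - σ (X s ω)) ^ 2 ∂P ≤ C3 * Real.sqrt (t - s) := by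
      intro r hr
      have hr' : r ∈ Set.Icc 0 T := ⟨hs.trans hr.1.le, hr.2.trans htT⟩
      have i0 : MemLp (fun ω => X r ω - X s ω) 2 P := (hC r hr').1.sub (hC s hs').1
      have i1 : MemLp (fun ω => σ (X r ω) - σ (X s ω)) 2 P := (hσ r hr').1.sub sL
      refine ⟨i1.integrable_sq, ?_⟩
      refine (integral_mono i1.integrable_sq ((i0.integrable one_le_two).abs.const_mul (c ^ 2))
        (fun ω => H.σhold _ _)).trans ?_
      rw [integral_const_mul, hC3, mul_assoc, ← Real.sqrt_mul C20]
      refine mul_le_mul_of_nonneg_left ?_ (sq_nonneg c)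
      refine (integral_abs_le_sqrt _ i0).trans (Real.sqrt_le_sqrt ?_)
      refine (hX s r hs hr.1.le hr'.2).trans ?_
      have := hr.2
      gcongr
    have F := fub (P := P) (fun r ω => (σ (X r ω) - σ (X s ω)) ^ 2)
      (((H.σcont.measurable.comp H.measX).sub
        ((H.σcont.measurable.comp (H.measX1 s)).comp measurable_snd)).pow_const 2) s t
      (C3 * Real.sqrt (t - s)) hst (fun r hr => (hZ r hr).1)
      (fun r hr => by simpa only [abs_sq] using (hZ r hr).2)
    have final : ∫ ω, (M t ω - M s ω - σ (X s ω) * (W t ω - W s ω)) ^ 2 ∂P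
        = ∫ ω, (∫ r in Set.Ioc s t, (σ (X r ω) - σ (X s ω)) ^ 2) ∂P := by
      have e1 : (fun ω => (M t ω - M s ω - σ (X s ω) * (W t ω - W s ω)) ^ 2)
          = fun ω => ((M t ω - M s ω) ^ 2 - 2 * ((M t ω - M s ω) * (σ (X s ω) * (W t ω - W s ω))))
            + σ (X s ω) ^ 2 * (W t ω - W s ω) ^ 2 := by
        funext ω; ring
      have e2 : (fun ω => ∫ r in Set.Ioc s t, (σ (X r ω) - σ (X s ω)) ^ 2)
          = fun ω => ((∫ r in Set.Ioc s t, σ (X r ω) ^ 2) - 2 * (σ (X s ω) * S ω))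
            + σ (X s ω) ^ 2 * (t - s) := by
        funext ω
        have : (fun r => (σ (X r ω) - σ (X s ω)) ^ 2)
          = fun r => (σ (X r ω) ^ 2 - (2 * σ (X s ω)) * σ (X r ω)) + σ (X s ω) ^ 2 := by
          funext r; ring
        have a1 : IntegrableOn (fun r => σ (X r ω) ^ 2 - (2 * σ (X s ω)) * σ (X r ω)) (Set.Ioc s t) :=
          (H.σint ω s t).sub ((H.σint1 ω s t).const_mul _)
        rw [this, integral_add a1 (integrable_const _),
          integral_sub (H.σint ω s t) ((H.σint1 ω s t).const_mul _), integral_const_mul, integral_const]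
        simp [Measure.real, hst, hS]
        ring
      have j1 : Integrable (fun ω => (M t ω - M s ω) ^ 2
          - 2 * ((M t ω - M s ω) * (σ (X s ω) * (W t ω - W s ω)))) P :=
        dM.integrable_sq.sub (c1.const_mul 2)
      have j2 : Integrable (fun ω => (∫ r in Set.Ioc s t, σ (X r ω) ^ 2) - 2 * (σ (X s ω) * S ω)) P :=
        (hQ s t hs hst htT).1.sub (c2.const_mul 2)
      rw [e1, e2, integral_add j1 uu.1, integral_add j2 (sL.integrable_sq.mul_const _),
        integral_sub dM.integrable_sq (c1.const_mul 2),
        integral_sub (hQ s t hs hst htT).1 (c2.const_mul 2), integral_const_mul, integral_const_mul,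
        integral_mul_const, uu.2, bm_sq hW hs hst, cross, (hΔM s t hs hst htT).2]
    rw [final]
    refine (abs_le.1 F.2.2.1).2.trans (le_of_eq ?_)
    ring
  refine ⟨C + C1 + C2 + C3, by positivity, fun t ht => ⟨(hC t ht).1, by linarith [(hC t ht).2]⟩,
    fun s t hs hst htT => ⟨⟨(hA s t hs hst htT).1, (hA s t hs hst htT).2.trans ?_⟩,
      (hX s t hs hst htT).trans ?_, (hR s t hs hst htT).1, (hR s t hs hst htT).2.trans ?_⟩⟩
  · exact mul_le_mul_of_nonneg_right (by linarith) (sq_nonneg _)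
  · exact mul_le_mul_of_nonneg_right (by linarith) (sub_nonneg.2 hst)
  · exact mul_le_mul_of_nonneg_right (by linarith)
      (mul_nonneg (sub_nonneg.2 hst) (Real.sqrt_nonneg _))
end incr

set_option linter.unusedSectionVars false

section step
variable {Ω : Type} [m : MeasurableSpace Ω] {P : Measure Ω} [IsProbabilityMeasure P]
variable {ℱ : Filtration ℝ m} {W : ℝ → Ω → ℝ} {σ : ℝ → ℝ} {c x₁ x₂ T B : ℝ}
variable {X₁ M₁ G₁ X₂ M₂ G₂ : ℝ → Ω → ℝ}

/-- Integrable with an upper bound on the integral. -/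
def IB (P : Measure Ω) (f : Ω → ℝ) (C : ℝ) : Prop := Integrable f P ∧ ∫ ω, f ω ∂P ≤ C

lemma IB.add {f g : Ω → ℝ} {C C' : ℝ} (hf : IB P f C) (hg : IB P g C') :
    IB P (fun ω => f ω + g ω) (C + C') := by
  refine ⟨hf.1.add hg.1, ?_⟩
  rw [integral_add hf.1 hg.1]
  exact add_le_add hf.2 hg.2

lemma IB.smul {f : Ω → ℝ} {C a : ℝ} (ha : 0 ≤ a) (hf : IB P f C) :
    IB P (fun ω => a * f ω) (a * C) := by
  refine ⟨hf.1.const_mul a, ?_⟩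
  rw [integral_const_mul]
  exact mul_le_mul_of_nonneg_left hf.2 ha

lemma IB.of_le {f g : Ω → ℝ} {C : ℝ} (hg : IB P g C) (hm : Measurable f) (h0 : ∀ ω, 0 ≤ f ω)
    (hfg : ∀ ω, f ω ≤ g ω) : IB P f C := by
  have hi : Integrable f P := by
    refine hg.1.mono' hm.aestronglyMeasurable (Eventually.of_forall fun ω => ?_)
    rw [Real.norm_of_nonneg (h0 ω)]
    exact hfg ω
  exact ⟨hi, (integral_mono hi hg.1 hfg).trans hg.2⟩

lemma IB.weaken {f : Ω → ℝ} {C C' : ℝ} (hf : IB P f C) (h : C ≤ C') : IB P f C' :=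
  ⟨hf.1, hf.2.trans h⟩

lemma IB.const (a : ℝ) : IB P (fun _ => a) a := ⟨integrable_const _, by simp⟩

lemma cube_le (x : ℝ) : |x| ^ 3 ≤ x ^ 2 + x ^ 4 := by
  have h4 : x ^ 4 = |x| ^ 4 := (Even.pow_abs (by decide : Even 4) x).symm
  rw [h4, ← sq_abs x]
  have : |x| ^ 2 + |x| ^ 4 - |x| ^ 3 = |x| ^ 2 * ((1 - |x|) ^ 2 + |x|) := by ring
  have h : 0 ≤ |x| ^ 2 * ((1 - |x|) ^ 2 + |x|) := by positivity
  linarith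

lemma four_sq (a b c d : ℝ) : (a - b + c - d) ^ 2 ≤ 4 * (a ^ 2 + b ^ 2 + c ^ 2 + d ^ 2) := by
  nlinarith [sq_nonneg (a + b), sq_nonneg (c + d), sq_nonneg (a - b - (c - d))]

lemma drift_pt {ε K L : ℝ} {φ φ' ρ : ℝ → ℝ} (hφ : GoodPhi ε φ φ' ρ K L) 
    (g1 g2 d : ℝ → ℝ) (a s t : ℝ) (hst : s ≤ t) (hd : Continuous d)
    (i1 : IntegrableOn g1 (Set.Ioc s t)) (i2 : IntegrableOn g2 (Set.Ioc s t))
    (hG : ∀ r ∈ Set.Ioc s t, ∃ b, 0 ≤ b ∧ b ≤ B ∧ g1 r - g2 r ≤ b * d r) :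
    φ' a * ((∫ r in Set.Ioc s t, g1 r) - ∫ r in Set.Ioc s t, g2 r)
      ≤ B * (t - s) * (a * φ' a) + B * K * (|a| * ∫ r in Set.Ioc s t, |d r - a|) := by
  have hV : IntegrableOn (fun r => |d r - a|) (Set.Ioc s t) :=
    ((hd.sub continuous_const).abs.integrableOn_Icc).mono_set Set.Ioc_subset_Icc_self
  have hc : IntegrableOn (fun _ : ℝ => B * (a * φ' a)) (Set.Ioc s t) := integrableOn_const (by simp)
  have e : φ' a * ((∫ r in Set.Ioc s t, g1 r) - ∫ r in Set.Ioc s t, g2 r)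
      = ∫ r in Set.Ioc s t, φ' a * (g1 r - g2 r) := by
    rw [integral_const_mul, integral_sub i1 i2]
  have e2 : B * (t - s) * (a * φ' a) + B * K * (|a| * ∫ r in Set.Ioc s t, |d r - a|)
      = ∫ r in Set.Ioc s t, (B * (a * φ' a) + B * K * |a| * |d r - a|) := by
    have e3 := integral_const_mul (μ := volume.restrict (Set.Ioc s t)) (B * K * |a|) (fun r => |d r - a|)
    rw [integral_add hc (hV.const_mul _), e3]
    simp [Measure.real, hst]
    ring
  rw [e, e2]
  refine setIntegral_mono_on ((i1.sub i2).const_mul _) (hc.add (hV.const_mul _)) measurableSet_Ioc ?_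
  intro r hr
  obtain ⟨b, b0, bB, hb⟩ := hG r hr
  have p0 := hφ.φ'_nonneg a
  have h1 : φ' a * (g1 r - g2 r) ≤ φ' a * (b * d r) := mul_le_mul_of_nonneg_left hb p0
  have h2 : b * (a * φ' a) ≤ B * (a * φ' a) := mul_le_mul_of_nonneg_right bB (hφ.xφ'_nonneg a)
  have h3 : φ' a ≤ K * |a| := (le_abs_self _).trans (hφ.φ'_le a)
  have h4 : φ' a * (b * (d r - a)) ≤ B * K * |a| * |d r - a| := by
    calc φ' a * (b * (d r - a)) ≤ φ' a * (b * |d r - a|) := by gcongr; exact le_abs_self _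
      _ ≤ (K * |a|) * (B * |d r - a|) := by
          have := hφ.K0
          gcongr
      _ = _ := by ring
  calc φ' a * (g1 r - g2 r) ≤ φ' a * (b * d r) := h1
    _ = b * (a * φ' a) + φ' a * (b * (d r - a)) := by ring
    _ ≤ _ := add_le_add h2 h4

set_option maxHeartbeats 2000000 in
/-- One step estimate. -/
lemma step_est (H₁ : SolHyp P ℱ W σ c x₁ T B X₁ M₁ G₁) (H₂ : SolHyp P ℱ W σ c x₂ T B X₂ M₂ G₂)
    (hW : IsBrownianMotion P ℱ W)
    (hG : ∀ r ∈ Set.Icc 0 T, ∀ ω, ∃ b, 0 ≤ b ∧ b ≤ B ∧ G₁ r ω - G₂ r ω ≤ b * (X₁ r ω - X₂ r ω))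
    {ε K L : ℝ} {φ φ' ρ : ℝ → ℝ} (hε : 0 < ε) (hε1 : ε ≤ 1) (hφ : GoodPhi ε φ φ' ρ K L) :
    (∀ t ∈ Set.Icc 0 T, Integrable (fun ω => φ (X₁ t ω - X₂ t ω)) P) ∧
    ∃ h0 > 0, ∀ s t, 0 ≤ s → s < t → t ≤ T → t - s ≤ h0 →
      ∫ ω, φ (X₁ t ω - X₂ t ω) ∂P ≤ ∫ ω, φ (X₁ s ω - X₂ s ω) ∂P
        + (2 * B + c ^ 2 + 1) * (t - s) * (∫ ω, φ (X₁ s ω - X₂ s ω) ∂P + ε) := by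
  obtain ⟨C₁, C₁0, hX₁, hI₁⟩ := H₁.incr hW
  obtain ⟨C₂, C₂0, hX₂, hI₂⟩ := H₂.incr hW
  obtain ⟨m3, m30, hm3⟩ := gauss_third
  have K0 := hφ.K0
  have L0 := hφ.L0
  have B0 := H₁.B0
  set S := C₁ + C₂ with hS
  have S0 : 0 ≤ S := by positivity
  have mD : ∀ t, Measurable (fun ω => X₁ t ω - X₂ t ω) := fun t => (H₁.measX1 t).sub (H₂.measX1 t)
  have LD : ∀ t ∈ Set.Icc 0 T, MemLp (fun ω => X₁ t ω - X₂ t ω) 2 P := fun t ht =>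
    (hX₁ t ht).1.sub (hX₂ t ht).1
  have D2 : ∀ t ∈ Set.Icc 0 T, IB P (fun ω => (X₁ t ω - X₂ t ω) ^ 2) (2 * S) := by
    intro t ht
    have a1 : IB P (fun ω => X₁ t ω ^ 2) C₁ := ⟨(hX₁ t ht).1.integrable_sq, (hX₁ t ht).2⟩
    have a2 : IB P (fun ω => X₂ t ω ^ 2) C₂ := ⟨(hX₂ t ht).1.integrable_sq, (hX₂ t ht).2⟩
    refine ((a1.add a2).smul (by norm_num : (0:ℝ) ≤ 2)).of_le ((mD t).pow_const 2)
      (fun ω => sq_nonneg _) (fun ω => ?_)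
    nlinarith [sq_nonneg (X₁ t ω + X₂ t ω)]
  have iφ : ∀ t ∈ Set.Icc 0 T, Integrable (fun ω => φ (X₁ t ω - X₂ t ω)) P := fun t ht =>
    (((D2 t ht).smul K0).of_le (hφ.cφ.measurable.comp (mD t)) (fun ω => hφ.φ_nonneg _)
      (fun ω => hφ.φ_le _)).1
  refine ⟨iφ, ?_⟩
  set Ct := 4 * B * K * S + L * ((c ^ 2 * (1 + 2 * S) + c ^ 4 * (2 * S)) * m3)
    + K * (c ^ 2 * (1 + 2 * S)) + 16 * K * S with hCt
  have Ct0 : 0 ≤ Ct := by positivity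
  set p0 := min 1 (ε / (Ct + 1)) with hp0
  have p00 : 0 < p0 := by positivity
  refine ⟨p0 ^ 4, by positivity, ?_⟩
  intro s t hs hst htT hh
  have hs' : s ∈ Set.Icc 0 T := ⟨hs, hst.le.trans htT⟩
  have ht' : t ∈ Set.Icc 0 T := ⟨hs.trans hst.le, htT⟩
  obtain ⟨p, pp, hp⟩ : ∃ p : ℝ, 0 < p ∧ t - s = p ^ 4 := by
    refine ⟨Real.sqrt (Real.sqrt (t - s)), ?_, ?_⟩
    · exact Real.sqrt_pos.2 (Real.sqrt_pos.2 (by linarith))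
    · rw [show (4:ℕ) = 2 * 2 from rfl, pow_mul, Real.sq_sqrt (Real.sqrt_nonneg _),
        Real.sq_sqrt (by linarith)]
  have hsq : Real.sqrt (t - s) = p ^ 2 := by
    rw [hp, show p ^ 4 = (p ^ 2) ^ 2 by ring, Real.sqrt_sq (by positivity)]
  have pp0 : p ≤ p0 := by
    rw [hp] at hh
    exact (pow_le_pow_iff_left₀ pp.le p00.le (by norm_num)).1 hh
  have p1 : p ≤ 1 := pp0.trans (min_le_left _ _)
  have pε : Ct * p ≤ ε := by
    have h1 : p ≤ ε / (Ct + 1) := pp0.trans (min_le_right _ _)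
    rw [le_div_iff₀ (by positivity)] at h1
    nlinarith
  have J₁ := hI₁ s t hs hst.le htT
  have J₂ := hI₂ s t hs hst.le htT
  rw [hsq, hp] at J₁ J₂
  -- abbreviations
  set D : Ω → ℝ := fun ω => X₁ s ω - X₂ s ω with hD
  set Y : Ω → ℝ := fun ω => σ (X₁ s ω) - σ (X₂ s ω) with hY
  set w : Ω → ℝ := fun ω => W t ω - W s ω with hw
  set A₁ : Ω → ℝ := fun ω => ∫ r in Set.Ioc s t, G₁ r ω with hA₁
  set A₂ : Ω → ℝ := fun ω => ∫ r in Set.Ioc s t, G₂ r ω with hA₂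
  set R₁ : Ω → ℝ := fun ω => M₁ t ω - M₁ s ω - σ (X₁ s ω) * (W t ω - W s ω) with hR₁
  set R₂ : Ω → ℝ := fun ω => M₂ t ω - M₂ s ω - σ (X₂ s ω) * (W t ω - W s ω) with hR₂
  set N : Ω → ℝ := fun ω => (M₁ t ω - M₁ s ω) - (M₂ t ω - M₂ s ω) with hN
  set V : Ω → ℝ := fun ω => ∫ r in Set.Ioc s t, |(X₁ r ω - X₂ r ω) - D ω| with hV
  have bD := D2 s hs'
  have mDs : Measurable[ℱ s] D := (H₁.adX s).sub (H₂.adX s)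
  have mYs : Measurable[ℱ s] Y :=
    (H₁.σcont.measurable.comp (H₁.adX s)).sub (H₁.σcont.measurable.comp (H₂.adX s))
  have mY : Measurable Y := mYs.mono (ℱ.le s) le_rfl
  have Yle : ∀ ω, Y ω ^ 2 ≤ c ^ 2 * |D ω| := fun ω => H₁.σhold _ _
  have absle : ∀ ω, |D ω| ≤ 1 + D ω ^ 2 := fun ω => by
    nlinarith [sq_abs (D ω), sq_nonneg (|D ω| - 1), abs_nonneg (D ω)]
  have Yle2 : ∀ ω, Y ω ^ 2 ≤ c ^ 2 * (1 + D ω ^ 2) := fun ω =>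
    (Yle ω).trans (mul_le_mul_of_nonneg_left (absle ω) (sq_nonneg c))
  have bY2 : IB P (fun ω => Y ω ^ 2) (c ^ 2 * (1 + 2 * S)) :=
    (((IB.const 1).add bD).smul (sq_nonneg c)).of_le (mY.pow_const 2) (fun ω => sq_nonneg _) Yle2
  have bY3 : IB P (fun ω => |Y ω| ^ 3) (c ^ 2 * (1 + 2 * S) + c ^ 4 * (2 * S)) := by
    refine ((((IB.const 1).add bD).smul (sq_nonneg c)).add (bD.smul (by positivity : 0 ≤ c ^ 4))).of_le
      (mY.abs.pow_const 3) (fun ω => by positivity) (fun ω => ?_)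
    have h1 := Yle2 ω
    have h2 : Y ω ^ 4 ≤ c ^ 4 * D ω ^ 2 := by
      calc Y ω ^ 4 = (Y ω ^ 2) ^ 2 := by ring
        _ ≤ (c ^ 2 * |D ω|) ^ 2 := by gcongr; exact Yle ω
        _ = _ := by rw [mul_pow, sq_abs]; ring
    have h3 : |Y ω| ^ 3 ≤ Y ω ^ 2 + Y ω ^ 4 := cube_le _
    simp only [hD] at h1 h2
    linarith
  -- Brownian terms
  have w2 : MemLp w 2 P := bm_memLp hW hs hst.le 2
  have w3 : Integrable (fun ω => |w ω| ^ 3) P := by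
    have h : MemLp w 3 P := bm_memLp hW hs hst.le 3
    simpa using h.integrable_norm_pow (by norm_num)
  have bρ : IB P (fun ω => ρ (D ω) * Y ω ^ 2 * w ω ^ 2) (c ^ 2 * ε * p ^ 4) := by
    have b : IB P (fun ω => ρ (D ω) * Y ω ^ 2) (c ^ 2 * ε) := by
      refine (IB.const (c ^ 2 * ε)).of_le ((hφ.cρ.measurable.comp (mD s)).mul (mY.pow_const 2))
        (fun ω => mul_nonneg (hφ.ρ_nonneg _) (sq_nonneg _)) (fun ω => ?_)
      calc ρ (D ω) * Y ω ^ 2 ≤ ρ (D ω) * (c ^ 2 * |D ω|) :=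
            mul_le_mul_of_nonneg_left (Yle ω) (hφ.ρ_nonneg _)
        _ = c ^ 2 * (ρ (D ω) * |D ω|) := by ring
        _ ≤ _ := mul_le_mul_of_nonneg_left (hφ.ρ_abs _) (sq_nonneg c)
    have h := bm_mul hW hs hst.le (fun ω => ρ (D ω) * Y ω ^ 2)
      ((hφ.cρ.measurable.comp mDs).mul (mYs.pow_const 2)) b.1 (fun x => x ^ 2) (by fun_prop) w2.integrable_sq
    refine ⟨h.1, ?_⟩
    rw [h.2, bm_sq hW hs hst.le, hp]
    exact mul_le_mul_of_nonneg_right b.2 (by positivity)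
  have bu2 : IB P (fun ω => Y ω ^ 2 * w ω ^ 2) (c ^ 2 * (1 + 2 * S) * p ^ 4) := by
    have h := bm_mul hW hs hst.le (fun ω => Y ω ^ 2)
      (mYs.pow_const 2) bY2.1 (fun x => x ^ 2) (by fun_prop) w2.integrable_sq
    refine ⟨h.1, ?_⟩
    rw [h.2, bm_sq hW hs hst.le, hp]
    exact mul_le_mul_of_nonneg_right bY2.2 (by positivity)
  have bu3 : IB P (fun ω => |Y ω| ^ 3 * |w ω| ^ 3)
      ((c ^ 2 * (1 + 2 * S) + c ^ 4 * (2 * S)) * (m3 * p ^ 6)) := by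
    have h := bm_mul hW hs hst.le (fun ω => |Y ω| ^ 3)
      ((continuous_abs.measurable.comp mYs).pow_const 3) bY3.1 (fun x => |x| ^ 3) (by fun_prop) w3
    refine ⟨h.1, ?_⟩
    rw [h.2, bm_integral hW hs hst.le (fun x => |x| ^ 3) (by fun_prop), hm3 _ (by linarith), hsq, hp,
      show p ^ 4 * p ^ 2 = p ^ 6 by ring]
    exact mul_le_mul_of_nonneg_right bY3.2 (by positivity)
  -- V
  have bV : IB P (fun ω => V ω ^ 2) (p ^ 4 * (2 * S * p ^ 4 * p ^ 4)) := by
    have mZ : Measurable (Function.uncurry fun r ω => (X₁ r ω - X₂ r ω) - D ω) :=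
      (H₁.measX.sub H₂.measX).sub ((mD s).comp measurable_snd)
    have b : ∀ r ∈ Set.Ioc s t, IB P (fun ω => ((X₁ r ω - X₂ r ω) - D ω) ^ 2) (2 * S * p ^ 4) := by
      intro r hr
      have hrT : r ≤ T := hr.2.trans htT
      have hr' : r ∈ Set.Icc 0 T := ⟨hs.trans hr.1.le, hrT⟩
      have a1 : IB P (fun ω => (X₁ r ω - X₁ s ω) ^ 2) (C₁ * p ^ 4) :=
        ⟨((hX₁ r hr').1.sub (hX₁ s hs').1).integrable_sq,
          ((hI₁ s r hs hr.1.le hrT).2.1).trans (by rw [← hp]; gcongr; exact hr.2)⟩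
      have a2 : IB P (fun ω => (X₂ r ω - X₂ s ω) ^ 2) (C₂ * p ^ 4) :=
        ⟨((hX₂ r hr').1.sub (hX₂ s hs').1).integrable_sq,
          ((hI₂ s r hs hr.1.le hrT).2.1).trans (by rw [← hp]; gcongr; exact hr.2)⟩
      refine (((a1.add a2).smul (by norm_num : (0:ℝ) ≤ 2)).of_le (((mD r).sub (mD s)).pow_const 2)
        (fun ω => sq_nonneg _) (fun ω => ?_)).weaken (le_of_eq (by rw [hS]; ring))
      change ((X₁ r ω - X₂ r ω) - (X₁ s ω - X₂ s ω)) ^ 2 ≤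
        2 * ((X₁ r ω - X₁ s ω) ^ 2 + (X₂ r ω - X₂ s ω) ^ 2)
      nlinarith [sq_nonneg ((X₁ r ω - X₁ s ω) + (X₂ r ω - X₂ s ω))]
    have h := fub (P := P) (fun r ω => ((X₁ r ω - X₂ r ω) - D ω) ^ 2) (mZ.pow_const 2) s t
      (2 * S * p ^ 4) hst.le (fun r hr => (b r hr).1) (fun r hr => by
        simpa only [abs_sq] using (b r hr).2)
    have b2 : IB P (fun ω => ∫ r in Set.Ioc s t, ((X₁ r ω - X₂ r ω) - D ω) ^ 2) (2 * S * p ^ 4 * p ^ 4) :=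
      ⟨h.1, (le_abs_self _).trans (by rw [← hp] ; rw [hp]; simpa only [hp] using h.2.2.1)⟩
    have mV : Measurable V := by
      have : StronglyMeasurable (Function.uncurry fun r ω => |(X₁ r ω - X₂ r ω) - D ω|) :=
        mZ.abs.stronglyMeasurable
      exact this.integral_prod_left.measurable
    refine (b2.smul (by positivity : 0 ≤ p ^ 4)).of_le (mV.pow_const 2) (fun ω => sq_nonneg _)
      (fun ω => ?_)
    have hc : Continuous fun r => (X₁ r ω - X₂ r ω) - D ω :=
      ((H₁.contX ω).sub (H₂.contX ω)).sub continuous_const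
    have := sq_setIntegral_le (fun r => |(X₁ r ω - X₂ r ω) - D ω|) s t hst.le
      (hc.abs.integrableOn_Icc.mono_set Set.Ioc_subset_Icc_self)
      ((hc.abs.pow 2).integrableOn_Icc.mono_set Set.Ioc_subset_Icc_self)
    simp only [sq_abs, hp] at this
    exact this
  -- martingale term
  have bN : IB P (fun ω => φ' (D ω) * N ω) 0 := by
    have n1 : MemLp (fun ω => M₁ t ω - M₁ s ω) 2 P := (H₁.ML2 t ht').sub (H₁.ML2 s hs')
    have n2 : MemLp (fun ω => M₂ t ω - M₂ s ω) 2 P := (H₂.ML2 t ht').sub (H₂.ML2 s hs')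
    have nn : MemLp N 2 P := n1.sub n2
    have q : MemLp (fun ω => φ' (D ω)) 2 P := by
      refine ((LD s hs').const_mul K).mono (hφ.cφ'.measurable.comp (mD s)).aestronglyMeasurable
        (Eventually.of_forall fun ω => ?_)
      rw [Real.norm_eq_abs, Real.norm_eq_abs, abs_mul, abs_of_nonneg K0]
      exact hφ.φ'_le _
    have i : Integrable (fun ω => φ' (D ω) * N ω) P := q.integrable_mul nn
    refine ⟨i, le_of_eq ?_⟩
    refine integral_mul_eq_zero_of_condExp (ℱ.le s) _ _ (hφ.cφ'.measurable.comp mDs).stronglyMeasurable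
      i (nn.integrable one_le_two) ?_
    refine (condExp_sub (n1.integrable one_le_two) (n2.integrable one_le_two) (ℱ s)).trans ?_
    filter_upwards [mart_incr H₁.martM hst.le, mart_incr H₂.martM hst.le] with ω h1 h2
    simp [h1, h2]
  set F := ∫ ω, φ (D ω) ∂P with hF
  have bφ : IB P (fun ω => φ (D ω)) F := ⟨iφ s hs', le_rfl⟩
  have bx : IB P (fun ω => D ω * φ' (D ω)) (F + ε * (F + ε)) := by
    refine (bφ.add ((bφ.add (IB.const ε)).smul hε.le)).of_le
      ((mD s).mul (hφ.cφ'.measurable.comp (mD s))) (fun ω => hφ.xφ'_nonneg _) (fun ω => hφ.xφ'_le _)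
  have bA₁ : IB P (fun ω => A₁ ω ^ 2) (C₁ * (p ^ 4) ^ 2) := ⟨J₁.1.1.integrable_sq, J₁.1.2⟩
  have bA₂ : IB P (fun ω => A₂ ω ^ 2) (C₂ * (p ^ 4) ^ 2) := ⟨J₂.1.1.integrable_sq, J₂.1.2⟩
  have bR₁ : IB P (fun ω => R₁ ω ^ 2) (C₁ * (p ^ 4 * p ^ 2)) := ⟨J₁.2.2.1.integrable_sq, J₁.2.2.2⟩
  have bR₂ : IB P (fun ω => R₂ ω ^ 2) (C₂ * (p ^ 4 * p ^ 2)) := ⟨J₂.2.2.1.integrable_sq, J₂.2.2.2⟩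
  have big := ((((((((bφ.add bN).add (bx.smul (by positivity : 0 ≤ B * p ^ 4))).add
    (bD.smul (by positivity : 0 ≤ B * K * p ^ 6))).add
    (bV.smul (by positivity : 0 ≤ B * K / p ^ 6))).add
    (bρ.smul (by norm_num : (0:ℝ) ≤ 1 / 2))).add (bu3.smul L0)).add
    (bu2.smul (by positivity : 0 ≤ K * p))).add
    ((((bA₁.add bA₂).add bR₁).add bR₂).smul (by positivity : 0 ≤ (K / p + K) * 4)))
  have fin := big.of_le (f := fun ω => φ (X₁ t ω - X₂ t ω)) (hφ.cφ.measurable.comp (mD t))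
    (fun ω => hφ.φ_nonneg _) ?_
  · refine fin.2.trans ?_
    have F0 : 0 ≤ F := integral_nonneg fun ω => hφ.φ_nonneg _
    have e1 : B * K / p ^ 6 * (p ^ 4 * (2 * S * p ^ 4 * p ^ 4)) = 2 * B * K * S * p ^ 6 := by
      field_simp
    have e2 : (K / p + K) * 4 * (C₁ * (p ^ 4) ^ 2 + C₂ * (p ^ 4) ^ 2 + C₁ * (p ^ 4 * p ^ 2)
        + C₂ * (p ^ 4 * p ^ 2)) = 4 * K * S * (p ^ 7 + p ^ 8 + p ^ 5 + p ^ 6) := by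
      rw [hS]; field_simp; ring
    rw [e1, e2, hp]
    have q6 : p ^ 6 ≤ p ^ 5 := pow_le_pow_of_le_one pp.le p1 (by norm_num)
    have q7 : p ^ 7 ≤ p ^ 5 := pow_le_pow_of_le_one pp.le p1 (by norm_num)
    have q8 : p ^ 8 ≤ p ^ 5 := pow_le_pow_of_le_one pp.le p1 (by norm_num)
    have t1 : B * K * p ^ 6 * (2 * S) ≤ 2 * B * K * S * p ^ 5 := by
      calc _ = 2 * B * K * S * p ^ 6 := by ring
        _ ≤ _ := by gcongr
    have t2 : 2 * B * K * S * p ^ 6 ≤ 2 * B * K * S * p ^ 5 := by gcongr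
    have t3 : L * ((c ^ 2 * (1 + 2 * S) + c ^ 4 * (2 * S)) * (m3 * p ^ 6))
        ≤ L * ((c ^ 2 * (1 + 2 * S) + c ^ 4 * (2 * S)) * m3) * p ^ 5 := by
      calc _ = L * ((c ^ 2 * (1 + 2 * S) + c ^ 4 * (2 * S)) * m3) * p ^ 6 := by ring
        _ ≤ _ := by gcongr
    have t4 : 4 * K * S * (p ^ 7 + p ^ 8 + p ^ 5 + p ^ 6) ≤ 16 * K * S * p ^ 5 := by
      calc _ ≤ 4 * K * S * (p ^ 5 + p ^ 5 + p ^ 5 + p ^ 5) := by gcongr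
        _ = _ := by ring
    have t5 : Ct * p ^ 5 ≤ ε * p ^ 4 := by
      calc Ct * p ^ 5 = (Ct * p) * p ^ 4 := by ring
        _ ≤ _ := by gcongr
    have t6 : B * p ^ 4 * (F + ε * (F + ε)) ≤ B * p ^ 4 * (2 * (F + ε)) := by
      gcongr
      nlinarith
    have t7 : 0 ≤ c ^ 2 * p ^ 4 * F := by positivity
    have t8 : 0 ≤ p ^ 4 * F := by positivity
    have t9 : 0 ≤ c ^ 2 * p ^ 4 * ε := by positivity
    have t10 : K * p * (c ^ 2 * (1 + 2 * S) * p ^ 4) = K * (c ^ 2 * (1 + 2 * S)) * p ^ 5 := by ring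
    rw [hCt] at t5
    linarith
  · intro ω
    have d1 := H₁.eqIncr s t hs hst.le ω
    have d2 := H₂.eqIncr s t hs hst.le ω
    have et : X₁ t ω - X₂ t ω = D ω + (Y ω * w ω + (A₁ ω - A₂ ω + R₁ ω - R₂ ω)) := by
      simp only [hD, hY, hw, hA₁, hA₂, hR₁, hR₂]
      linarith
    have eN : Y ω * w ω + (A₁ ω - A₂ ω + R₁ ω - R₂ ω) = N ω + (A₁ ω - A₂ ω) := by
      simp only [hY, hw, hN, hR₁, hR₂]
      ring
    set z := A₁ ω - A₂ ω + R₁ ω - R₂ ω with hz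
    have ty := hφ.taylor (D ω) (Y ω * w ω) z
    rw [← et] at ty
    refine ty.trans ?_
    rw [eN]
    have dp := drift_pt (B := B) hφ (fun r => G₁ r ω) (fun r => G₂ r ω) (fun r => X₁ r ω - X₂ r ω) (D ω) s t
      hst.le ((H₁.contX ω).sub (H₂.contX ω))
      ((H₁.Gint ω t).mono_set (Set.Ioc_subset_Ioc_left hs))
      ((H₂.Gint ω t).mono_set (Set.Ioc_subset_Ioc_left hs))
      (fun r hr => hG r ⟨hs.trans hr.1.le, hr.2.trans htT⟩ ω)
    rw [hp] at dp
    change φ' (D ω) * (A₁ ω - A₂ ω) ≤ B * p ^ 4 * (D ω * φ' (D ω)) + B * K * (|D ω| * V ω) at dp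
    have v1 : |D ω| * V ω ≤ p ^ 6 * D ω ^ 2 + V ω ^ 2 / p ^ 6 := by
      have q : 0 < p ^ 6 := by positivity
      rw [← sq_abs (D ω)]
      have := sq_nonneg (p ^ 6 * |D ω| - V ω)
      have h2 : 0 ≤ p ^ 6 * |D ω| ^ 2 := by positivity
      have h3 : 0 ≤ V ω ^ 2 / p ^ 6 := by positivity
      have h4 : (p ^ 6 * |D ω| - V ω) ^ 2 / p ^ 6 = p ^ 6 * |D ω| ^ 2 - 2 * (|D ω| * V ω) + V ω ^ 2 / p ^ 6 := by
        field_simp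
        ring
      have h5 : 0 ≤ (p ^ 6 * |D ω| - V ω) ^ 2 / p ^ 6 := by positivity
      linarith
    have v2 : |Y ω * w ω| * |z| ≤ p * (Y ω ^ 2 * w ω ^ 2) + z ^ 2 / p := by
      rw [← mul_pow, ← sq_abs (Y ω * w ω), ← sq_abs z]
      have h2 : 0 ≤ p * |Y ω * w ω| ^ 2 := by positivity
      have h3 : 0 ≤ |z| ^ 2 / p := by positivity
      have h4 : (p * |Y ω * w ω| - |z|) ^ 2 / p = p * |Y ω * w ω| ^ 2 - 2 * (|Y ω * w ω| * |z|) + |z| ^ 2 / p := by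
        field_simp
        ring
      have h5 : 0 ≤ (p * |Y ω * w ω| - |z|) ^ 2 / p := by positivity
      linarith
    have v3 : z ^ 2 ≤ 4 * (A₁ ω ^ 2 + A₂ ω ^ 2 + R₁ ω ^ 2 + R₂ ω ^ 2) := four_sq _ _ _ _
    have v4 : (K / p + K) * z ^ 2 ≤ (K / p + K) * (4 * (A₁ ω ^ 2 + A₂ ω ^ 2 + R₁ ω ^ 2 + R₂ ω ^ 2)) :=
      mul_le_mul_of_nonneg_left v3 (by positivity)
    have v1' := mul_le_mul_of_nonneg_left v1 (by positivity : 0 ≤ B * K)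
    have v2' := mul_le_mul_of_nonneg_left v2 K0
    have v5 : |Y ω * w ω| ^ 3 = |Y ω| ^ 3 * |w ω| ^ 3 := by rw [abs_mul, mul_pow]
    have v6 : ρ (D ω) * (Y ω * w ω) ^ 2 / 2 = 1 / 2 * (ρ (D ω) * Y ω ^ 2 * w ω ^ 2) := by ring
    rw [v5, v6]
    have v7 : B * K * (p ^ 6 * D ω ^ 2 + V ω ^ 2 / p ^ 6)
        = B * K * p ^ 6 * D ω ^ 2 + B * K / p ^ 6 * V ω ^ 2 := by ring
    have v8 : K * (p * (Y ω ^ 2 * w ω ^ 2) + z ^ 2 / p) + K * z ^ 2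
        = K * p * (Y ω ^ 2 * w ω ^ 2) + (K / p + K) * z ^ 2 := by ring
    rw [v7] at v1'
    have v9 : K * |Y ω * w ω| * |z| = K * (|Y ω * w ω| * |z|) := by ring
    have v10 : φ' (D ω) * (N ω + (A₁ ω - A₂ ω)) = φ' (D ω) * N ω + φ' (D ω) * (A₁ ω - A₂ ω) := by ring
    rw [v9, v10]
    change _ ≤ φ (D ω) + φ' (D ω) * N ω + B * p ^ 4 * (D ω * φ' (D ω)) + B * K * p ^ 6 * (D ω) ^ 2
      + B * K / p ^ 6 * V ω ^ 2 + 1 / 2 * (ρ (D ω) * Y ω ^ 2 * w ω ^ 2) + L * (|Y ω| ^ 3 * |w ω| ^ 3)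
      + K * p * (Y ω ^ 2 * w ω ^ 2) + (K / p + K) * 4 * (A₁ ω ^ 2 + A₂ ω ^ 2 + R₁ ω ^ 2 + R₂ ω ^ 2)
    linarith

/-- Comparison for abstract solutions. -/
lemma gbesq_compare (H₁ : SolHyp P ℱ W σ c x₁ T B X₁ M₁ G₁) (H₂ : SolHyp P ℱ W σ c x₂ T B X₂ M₂ G₂)
    (hW : IsBrownianMotion P ℱ W) (hx : x₁ ≤ x₂)
    (hG : ∀ r ∈ Set.Icc 0 T, ∀ ω, ∃ b, 0 ≤ b ∧ b ≤ B ∧ G₁ r ω - G₂ r ω ≤ b * (X₁ r ω - X₂ r ω)) :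
    ∀ᵐ ω ∂P, X₁ T ω ≤ X₂ T ω := by
  have T0 := H₁.T0
  have B0 := H₁.B0
  set k := 2 * B + c ^ 2 + 1 with hk
  have k0 : 0 ≤ k := by positivity
  have TT : T ∈ Set.Icc 0 T := ⟨T0, le_rfl⟩
  have hstart : ∀ ω, X₁ 0 ω - X₂ 0 ω ≤ 0 := fun ω => by
    rw [H₁.eq 0 ω, H₂.eq 0 ω, H₁.M0, H₂.M0]
    simp
    exact hx
  have iD : Integrable (fun ω => max (X₁ T ω - X₂ T ω) 0) P := by
    obtain ⟨_, _, h1⟩ := H₁.XL2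
    obtain ⟨_, _, h2⟩ := H₂.XL2
    exact (((h1 T TT).1.sub (h2 T TT).1).integrable one_le_two).pos_part
  have key : ∀ ε : ℝ, 0 < ε → ε ≤ 1 →
      ∫ ω, max (X₁ T ω - X₂ T ω) 0 ∂P ≤ (Real.exp (k * T) + 1) * ε := by
    intro ε hε hε1
    obtain ⟨φ, φ', ρ, K, L, hφ⟩ := exists_phi ε hε
    obtain ⟨hi, h0, h0p, hstep⟩ := step_est H₁ H₂ hW hG hε hε1 hφ
    set f : ℝ → ℝ := fun t => ∫ ω, φ (X₁ t ω - X₂ t ω) ∂P with hf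
    have f0 : ∀ t, 0 ≤ f t := fun t => integral_nonneg fun ω => hφ.φ_nonneg _
    have fz : f 0 = 0 := by
      simp only [hf]
      rw [integral_congr_ae (g := fun _ => (0:ℝ)) (Eventually.of_forall fun ω => hφ.φ_zero _ (hstart ω))]
      simp
    have hfT : f T + ε ≤ Real.exp (k * T) * ε := by
      obtain ⟨n, hn⟩ := exists_nat_gt (T / h0)
      set N : ℕ := n + 1 with hN
      have Npos : (0:ℝ) < N := by positivity
      have hd : T / N ≤ h0 := by
        rw [div_le_iff₀ Npos]
        rw [div_lt_iff₀ h0p] at hn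
        rw [hN]; push_cast
        nlinarith
      have d0 : 0 ≤ T / N := by positivity
      have ind : ∀ j : ℕ, j ≤ N → f (j * (T / N)) + ε ≤ Real.exp (k * (j * (T / N))) * ε := by
        intro j
        induction j with
        | zero => intro _; simp [fz]
        | succ j ih =>
          intro hj
          have ih := ih (by omega)
          rcases d0.eq_or_lt with hz | hz
          · rw [← hz] at ih ⊢
            simpa using ih
          · have e : ((j + 1 : ℕ) : ℝ) * (T / N) - j * (T / N) = T / N := by push_cast; ring
            have hjN : ((j + 1 : ℕ) : ℝ) * (T / N) ≤ T := by
              have : ((j + 1 : ℕ) : ℝ) ≤ N := by exact_mod_cast hj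
              calc ((j + 1 : ℕ) : ℝ) * (T / N) ≤ N * (T / N) := by gcongr
                _ = T := by field_simp
            have st := hstep (j * (T / N)) ((j + 1 : ℕ) * (T / N)) (by positivity) (by linarith) hjN
              (by rw [e]; exact hd)
            rw [e] at st
            change f _ ≤ f _ + k * (T / N) * (f _ + ε) at st
            have ex : k * (T / N) + 1 ≤ Real.exp (k * (T / N)) := Real.add_one_le_exp _
            have e3 : Real.exp (k * (((j + 1 : ℕ) : ℝ) * (T / N)))
                = Real.exp (k * (T / N)) * Real.exp (k * (j * (T / N))) := by
              rw [← Real.exp_add]; congr 1; push_cast; ring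
            rw [e3]
            have g0 : 0 ≤ f (j * (T / N)) + ε := add_nonneg (f0 _) hε.le
            calc f (((j + 1 : ℕ) : ℝ) * (T / N)) + ε ≤ (k * (T / N) + 1) * (f (j * (T / N)) + ε) := by linarith
              _ ≤ Real.exp (k * (T / N)) * (Real.exp (k * (j * (T / N))) * ε) := by gcongr
              _ = _ := by ring
      have := ind N le_rfl
      rwa [show (N : ℝ) * (T / N) = T by field_simp] at this
    have b : IB P (fun ω => φ (X₁ T ω - X₂ T ω)) (f T) := ⟨hi T TT, le_rfl⟩
    have m1 : Measurable fun ω => max (X₁ T ω - X₂ T ω) 0 :=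
      ((H₁.measX1 T).sub (H₂.measX1 T)).max measurable_const
    have := ((b.add (IB.const ε)).of_le m1 (fun ω => le_max_right _ _) (fun ω =>
      max_le (hφ.le_φ _) (add_nonneg (hφ.φ_nonneg _) hε.le))).2
    nlinarith
  have z : ∫ ω, max (X₁ T ω - X₂ T ω) 0 ∂P = 0 := by
    refine le_antisymm ?_ (integral_nonneg fun ω => le_max_right _ _)
    refine le_of_forall_pos_le_add fun η hη => ?_
    have E0 := Real.exp_pos (k * T)
    have h1 := key (min 1 (η / (Real.exp (k * T) + 1))) (by positivity) (min_le_left _ _)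
    refine h1.trans ?_
    calc _ ≤ (Real.exp (k * T) + 1) * (η / (Real.exp (k * T) + 1)) := by gcongr; exact min_le_right _ _
      _ = 0 + η := by field_simp; ring
  have z2 := (integral_eq_zero_iff_of_nonneg (μ := P) (f := fun ω => max (X₁ T ω - X₂ T ω) 0)
    (fun ω => le_max_right _ _) iD).1 z
  filter_upwards [z2] with ω hω
  have : X₁ T ω - X₂ T ω ≤ 0 := by
    have h := le_max_left (X₁ T ω - X₂ T ω) 0
    rw [show max (X₁ T ω - X₂ T ω) 0 = 0 from hω] at h
    exact h
  linarith

end step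

set_option linter.unusedSectionVars false

section final
variable {Ω : Type} [m : MeasurableSpace Ω] {P : Measure Ω} [IsProbabilityMeasure P]
variable {ℱ : Filtration ℝ m} {W : ℝ → Ω → ℝ} {σ : ℝ → ℝ} {c x T B : ℝ}
variable {X : ℝ → Ω → ℝ} {β δ : ℝ → ℝ}

lemma gint (hβ : MemD β) (hδ : MemD δ) (y : ℝ → ℝ) (hy : Continuous y) (t : ℝ) :
    IntegrableOn (fun r => gbesqDrift β δ r (y r)) (Set.Icc 0 t) := by
  obtain ⟨b, hb⟩ := hβ.2.2.1 t
  obtain ⟨d, hd⟩ := hδ.2.2.1 t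
  have hg : IntegrableOn (fun r => 2 * b * |y r| + d) (Set.Icc 0 t) :=
    ((continuous_const.mul hy.abs).add continuous_const).integrableOn_Icc
  refine Integrable.mono' hg ?_ ?_
  · unfold gbesqDrift
    exact (((hβ.1.const_mul 2).mul hy.measurable).add hδ.1).aestronglyMeasurable
  · refine (ae_restrict_iff' measurableSet_Icc).2 (Eventually.of_forall fun r hr => ?_)
    unfold gbesqDrift
    rw [Real.norm_eq_abs]
    refine (abs_add_le _ _).trans ?_
    rw [abs_mul, abs_of_nonneg (hδ.2.1 r), abs_of_nonneg (mul_nonneg zero_le_two (hβ.2.1 r))]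
    have := hb r hr
    have := hd r hr
    gcongr

lemma cont_prim (g : ℝ → ℝ) (hg : ∀ t, IntegrableOn g (Set.Icc 0 t)) :
    Continuous fun t => ∫ r in Set.Ioc 0 t, g r := by
  have e : (fun t => ∫ r in Set.Ioc 0 t, g r)
      = fun t => ∫ r in (0:ℝ)..t, (Set.Ioi (0:ℝ)).indicator g r := by
    funext t
    rcases le_total 0 t with ht | ht
    · rw [intervalIntegral.integral_of_le ht, setIntegral_indicator measurableSet_Ioi]
      congr 2
      ext r; simp
    · rw [intervalIntegral.integral_of_ge ht, setIntegral_indicator measurableSet_Ioi,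
        Set.Ioc_eq_empty (by simpa using ht)]
      have : Set.Ioc t 0 ∩ Set.Ioi 0 = ∅ := by ext r; simp
      rw [this]; simp
  rw [e]
  refine intervalIntegral.continuous_primitive (fun a b => ?_) 0
  have h1 : Integrable ((Set.Ioi (0:ℝ)).indicator g) (volume.restrict (Set.uIoc a b)) := by
    rw [integrable_indicator_iff measurableSet_Ioi, IntegrableOn, Measure.restrict_restrict measurableSet_Ioi]
    refine (hg (max a b)).mono_set ?_
    intro r hr
    exact ⟨(Set.mem_Ioi.1 hr.1).le, hr.2.2⟩
  exact intervalIntegrable_iff.2 h1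

lemma solHyp_of (hβ : MemD β) (hδ : MemD δ) (hσ0 : σ 0 = 0)
    (hc : 0 ≤ c) (hHolder : ∀ x y : ℝ, |σ x - σ y| ≤ c * Real.sqrt |x - y|)
    (h : IsSDESolution P ℱ W (gbesqDrift β δ) σ x X) (hT : 0 ≤ T) (hB : 0 ≤ B)
    (hβB : ∀ r ∈ Set.Icc 0 T, 2 * β r ≤ B) (hδB : ∀ r ∈ Set.Icc 0 T, δ r ≤ B) :
    SolHyp P ℱ W σ c x T B X
      (fun t ω => X t ω - x - ∫ s in Set.Ioc (0 : ℝ) t, gbesqDrift β δ s (X s ω))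
      (fun s ω => gbesqDrift β δ s (X s ω)) where
  c0 := hc
  T0 := hT
  B0 := hB
  σcont := by
    rw [continuous_iff_continuousAt]
    intro y
    rw [ContinuousAt, tendsto_iff_dist_tendsto_zero]
    have hl : Tendsto (fun z => c * Real.sqrt |z - y|) (nhds y) (nhds 0) := by
      have : Continuous fun z => c * Real.sqrt |z - y| := by fun_prop
      simpa using this.tendsto y
    exact squeeze_zero (fun z => dist_nonneg) (fun z => by rw [Real.dist_eq]; exact hHolder z y) hl
  σsq := fun y => by
    have := hHolder y 0
    rw [hσ0, sub_zero, sub_zero] at this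
    have h2 := pow_le_pow_left₀ (abs_nonneg _) this 2
    rwa [sq_abs, mul_pow, Real.sq_sqrt (abs_nonneg _)] at h2
  σhold := fun y z => by
    have h2 := pow_le_pow_left₀ (abs_nonneg _) (hHolder y z) 2
    rwa [sq_abs, mul_pow, Real.sq_sqrt (abs_nonneg _)] at h2
  contX := h.cont
  adX := h.adapted
  contM := fun ω => ((h.cont ω).sub continuous_const).sub
    (cont_prim _ fun t => gint hβ hδ _ (h.cont ω) t)
  martM := h.drift_mart
  M0 := fun ω => by simp [h.init ω]
  qv := h.quad_var
  dr := h.driven_by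
  measG := by
    have hX : Measurable (Function.uncurry X) := measurable_uncurry_of_continuous_of_measurable h.cont
      fun t => (h.adapted t).mono (ℱ.le t) le_rfl
    exact (((hβ.1.comp measurable_fst).const_mul 2).mul hX).add (hδ.1.comp measurable_fst)
  Gint := fun ω t => (gint hβ hδ _ (h.cont ω) t).mono_set Set.Ioc_subset_Icc_self
  Gle := fun r hr ω => by
    unfold gbesqDrift
    refine (abs_add_le _ _).trans ?_
    rw [abs_mul, abs_of_nonneg (hδ.2.1 r), abs_of_nonneg (mul_nonneg zero_le_two (hβ.2.1 r))]
    have h1 := hβB r hr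
    have h2 := hδB r hr
    have := mul_le_mul_of_nonneg_right h1 (abs_nonneg (X r ω))
    linarith
  eq := fun t ω => by ring

end final

/-- Comparison theorem for generalized squared Bessel type SDEs driven by the
same Brownian motion, with the same drift `β` and ordered dimensions. -/
theorem gbesq_comparison {Ω : Type} [m : MeasurableSpace Ω]
    (P : Measure Ω) [IsProbabilityMeasure P] (ℱ : Filtration ℝ m)
    (W : ℝ → Ω → ℝ) (hW : IsBrownianMotion P ℱ W)
    (β δ₁ δ₂ : ℝ → ℝ) (hβ : MemD β) (hδ₁ : MemD δ₁) (hδ₂ : MemD δ₂)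
    (σ : ℝ → ℝ) (hσ0 : σ 0 = 0) (hσpos : ∀ y, 0 ≤ σ y)
    (c : ℝ) (hHolder : ∀ x y : ℝ, |σ x - σ y| ≤ c * Real.sqrt |x - y|)
    (x₁ x₂ : ℝ) (hx₁ : 0 < x₁) (hx₂ : 0 < x₂) (hx : x₁ ≤ x₂)
    (hδ : ∀ u : ℝ, 0 ≤ u → δ₁ u ≤ δ₂ u)
    (X₁ X₂ : ℝ → Ω → ℝ)
    (h₁ : IsSDESolution P ℱ W (gbesqDrift β δ₁) σ x₁ X₁)
    (h₂ : IsSDESolution P ℱ W (gbesqDrift β δ₂) σ x₂ X₂) :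
    ∀ u : ℝ, 0 ≤ u → P {ω | X₁ u ω ≤ X₂ u ω} = 1 := by
  intro T hT
  have hc : 0 ≤ c := by
    have := (abs_nonneg _).trans (hHolder 1 0)
    simpa using this
  obtain ⟨b, hb⟩ := hβ.2.2.1 T
  obtain ⟨d, hd⟩ := hδ₂.2.2.1 T
  set B := 2 * |b| + |d| with hB
  have B0 : 0 ≤ B := by positivity
  have hβB : ∀ r ∈ Set.Icc 0 T, 2 * β r ≤ B := fun r hr => by
    have := hb r hr
    have := le_abs_self b
    have := abs_nonneg d
    linarith
  have hδ₂B : ∀ r ∈ Set.Icc 0 T, δ₂ r ≤ B := fun r hr => by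
    have := hd r hr
    have := le_abs_self d
    have := abs_nonneg b
    linarith
  have hδ₁B : ∀ r ∈ Set.Icc 0 T, δ₁ r ≤ B := fun r hr => (hδ r hr.1).trans (hδ₂B r hr)
  have H₁ := solHyp_of hβ hδ₁ hσ0 hc hHolder h₁ hT B0 hβB hδ₁B
  have H₂ := solHyp_of hβ hδ₂ hσ0 hc hHolder h₂ hT B0 hβB hδ₂B
  have key := gbesq_compare H₁ H₂ hW hx (fun r hr ω => ⟨2 * β r, mul_nonneg zero_le_two (hβ.2.1 r), hβB r hr, by
    have := hδ r hr.1
    simp only [gbesqDrift]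
    linarith⟩)
  have ms : MeasurableSet {ω | X₁ T ω ≤ X₂ T ω} := measurableSet_le (H₁.measX1 T) (H₂.measX1 T)
  exact (prob_compl_eq_zero_iff ms).1 key
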